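/- Let 0 ≤ α, β < ∞, 1 ≤ r ≤ ∞ and 0 < q < ∞. Assume α + β > 2/q − 1/2 and that one of the following holds: (i) max{α,β} ≥ 1/q and 2·min{α,β} > 2/q − 1/r′; (ii) max{α,β} < 1/q and α + β + min{α,β} > 3/q − 1/r′. Then there is a constant C > 0 such that for every measurable F : ℝ → ℂ one has ‖R*_{α,β}F‖_{L^q(ℝ²)} ≤ C · ‖F‖_{L^r(S¹)}. -/

import Mathlib

open MeasureTheory Real Set Filter
open scoped ENNReal

noncomputable section

/-- Fourier extension operator of the unit circle,
`(R*F)(x,y) = (1/(2π)) ∫_0^{2π} F(φ) exp(i(x cos φ + y sin φ)) dφ`. -/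
def Rext (F : ℝ → ℂ) (x y : ℝ) : ℂ :=
  Complex.ofReal (1 / (2 * π)) *
    ∫ φ in (0:ℝ)..(2 * π),
      F φ * Complex.exp (Complex.I * Complex.ofReal (x * Real.cos φ + y * Real.sin φ))

/-- Weighted extension operator with product weight `(1+|x|)^{-α}(1+|y|)^{-β}`. -/
def Rab (α β : ℝ) (F : ℝ → ℂ) (x y : ℝ) : ℂ :=
  Rext F x y * Complex.ofReal ((1 + |x|) ^ (-α) * (1 + |y|) ^ (-β))

/-- Weighted extension operator with weight `(1+|x|+|y|)^{-γ}`. -/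
def Rgamma (γ : ℝ) (F : ℝ → ℂ) (x y : ℝ) : ℂ :=
  Rext F x y * Complex.ofReal ((1 + |x| + |y|) ^ (-γ))

/-- `L^r` norm on the circle, parametrized by `[0, 2π]`. -/
def circleLp (r : ℝ≥0∞) (F : ℝ → ℂ) : ℝ≥0∞ :=
  eLpNorm F r (volume.restrict (Ioc (0:ℝ) (2 * π)))

/-- `L^q` quasinorm on the plane. -/
def planeLp (q : ℝ≥0∞) (g : ℝ × ℝ → ℂ) : ℝ≥0∞ :=
  eLpNorm g q (volume : Measure (ℝ × ℝ))

/-- Weak `L^q` quasinorm on the line. -/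
def wline (q : ℝ) (g : ℝ → ℂ) : ℝ≥0∞ :=
  ⨆ (t : ℝ) (_ : 0 < t), ENNReal.ofReal t * (volume {x : ℝ | t < ‖g x‖}) ^ (1 / q)

/-- Weak `L^q` quasinorm on the line, for `ℝ≥0∞`-valued functions. -/
def wlineE (q : ℝ) (g : ℝ → ℝ≥0∞) : ℝ≥0∞ :=
  ⨆ (t : ℝ) (_ : 0 < t), ENNReal.ofReal t * (volume {x : ℝ | ENNReal.ofReal t < g x}) ^ (1 / q)

/-- Mixed weak quasinorm `L^{q,∞}_x(L^{q,∞}_y)`. -/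
def mixedXY (q : ℝ) (g : ℝ × ℝ → ℂ) : ℝ≥0∞ :=
  wlineE q fun x => wline q fun y => g (x, y)

/-- Mixed weak quasinorm `L^{q,∞}_y(L^{q,∞}_x)`. -/
def mixedYX (q : ℝ) (g : ℝ × ℝ → ℂ) : ℝ≥0∞ :=
  wlineE q fun y => wline q fun x => g (x, y)

/-- Weak `L^q` quasinorm on the plane. -/
def wplane (q : ℝ) (g : ℝ × ℝ → ℂ) : ℝ≥0∞ :=
  ⨆ (t : ℝ) (_ : 0 < t), ENNReal.ofReal t * (volume {p : ℝ × ℝ | t < ‖g p‖}) ^ (1 / q)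

/-- Lorentz `L^{r,1}` norm on the circle. -/
def lorentz1 (r : ℝ) (F : ℝ → ℂ) : ℝ≥0∞ :=
  ∫⁻ t in Ioi (0:ℝ), (volume {φ ∈ Icc (0:ℝ) (2 * π) | t < ‖F φ‖}) ^ (1 / r)

/-- Weak `L^r` quasinorm on the circle. -/
def wcircle (r : ℝ) (F : ℝ → ℂ) : ℝ≥0∞ :=
  ⨆ (t : ℝ) (_ : 0 < t), ENNReal.ofReal t * (volume {φ ∈ Icc (0:ℝ) (2 * π) | t < ‖F φ‖}) ^ (1 / r)



open scoped FourierTransform InnerProductSpace ContDiff in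
theorem plancherel_L1L2 {V : Type*} [NormedAddCommGroup V] [InnerProductSpace ℝ V]
    [FiniteDimensional ℝ V] [MeasurableSpace V] [BorelSpace V] (h : V → ℂ)
    (h1 : Integrable h) (h2 : MemLp h 2) :
    eLpNorm (𝓕 h) 2 volume = eLpNorm h 2 volume := by
  set H : Lp (α := V) ℂ 2 volume := h2.toLp h with hH
  have key : ∀ᵐ x : V, (𝓕 H : Lp (α := V) ℂ 2 volume) x = 𝓕 h x := by
    apply ae_eq_of_integral_contDiff_smul_eq
    · exact (Lp.memLp _).locallyIntegrable (by norm_num)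
    · have : Continuous (𝓕 h) :=
        VectorFourier.fourierIntegral_continuous Real.continuous_fourierChar
          (by exact continuous_inner) h1
      exact this.locallyIntegrable
    · intro g hg hgc
      have hc : HasCompactSupport (fun x => (g x : ℂ)) := hgc.comp_left (g := fun t : ℝ => (t : ℂ)) (by simp)
      have hs : ContDiff ℝ ∞ (fun x => (g x : ℂ)) := Complex.ofRealCLM.contDiff.comp hg
      set ψ : SchwartzMap V ℂ := hc.toSchwartzMap hs with hψ
      have e1 := congrArg (fun T : TemperedDistribution V ℂ => T ψ) (Lp.fourier_toTemperedDistribution_eq H)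
      simp only [TemperedDistribution.fourier_apply, Lp.toTemperedDistribution_apply] at e1
      have e2 : ∫ x, g x • (𝓕 H : Lp (α := V) ℂ 2 volume) x = ∫ x, ψ x • (𝓕 H : Lp (α := V) ℂ 2 volume) x := by
        congr 1
      rw [e2, ← e1]
      have e3 : ∫ x, (𝓕 ψ) x • H x = ∫ x, (𝓕 ψ) x • h x := by
        apply integral_congr_ae
        filter_upwards [h2.coeFn_toLp] with x hx
        rw [hH, hx]
      rw [e3]
      have := VectorFourier.integral_fourierIntegral_smul_eq_flip (μ := (volume : Measure V)) (ν := (volume : Measure V))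
        (L := innerₗ V) Real.continuous_fourierChar (by exact continuous_inner)
        ψ.integrable h1
      rw [SchwartzMap.fourier_coe]
      rw [flip_innerₗ] at this
      exact this
  have : eLpNorm (𝓕 h) 2 volume = eLpNorm (𝓕 H : Lp (α := V) ℂ 2 volume) 2 volume :=
    (eLpNorm_congr_ae key).symm
  rw [this]
  have e4 := Lp.norm_fourier_eq H
  rw [Lp.norm_def, Lp.norm_def, ENNReal.toReal_eq_toReal_iff' (Lp.eLpNorm_ne_top _) (Lp.eLpNorm_ne_top _)] at e4
  rw [e4]
  exact eLpNorm_congr_ae h2.coeFn_toLp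


open scoped FourierTransform InnerProductSpace ComplexConjugate in
theorem ext_L2 {V : Type*} [NormedAddCommGroup V] [InnerProductSpace ℝ V]
    [FiniteDimensional ℝ V] [MeasurableSpace V] [BorelSpace V]
    {X : Type*} [MeasurableSpace X] (ν : Measure X) [IsFiniteMeasure ν]
    (Φ : X → V) (hΦ : Measurable Φ) (M : ℝ≥0∞) 
    (hν : ν.map Φ ≤ M • (volume : Measure V)) (f : X → ℂ) (hf : Measurable f) (L : ℝ)
    (hL : ∀ᵐ p ∂ν, ‖f p‖ ≤ L) :
    ∫⁻ ξ : V, ‖∫ p, (𝐞 (-⟪Φ p, ξ⟫_ℝ) : ℂ) * f p ∂ν‖ₑ ^ (2:ℝ) ≤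
      M * ∫⁻ p, ‖f p‖ₑ ^ (2:ℝ) ∂ν := by
  set B : V → ℂ := fun ξ => ∫ p, (𝐞 (-⟪Φ p, ξ⟫_ℝ) : ℂ) * f p ∂ν with hB
  have hmeas2 : Measurable (fun z : V × X => (𝐞 (-⟪Φ z.2, z.1⟫_ℝ) : ℂ)) := by
    have h1 : Measurable (fun z : V × X => (-⟪Φ z.2, z.1⟫_ℝ)) :=
      ((hΦ.comp measurable_snd).inner measurable_fst).neg
    have h2 : Continuous (fun t : ℝ => (𝐞 t : ℂ)) := by fun_prop
    exact h2.measurable.comp h1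
  have hBm : Measurable B := by
    have : StronglyMeasurable (fun z : V × X => (𝐞 (-⟪Φ z.2, z.1⟫_ℝ) : ℂ) * f z.2) :=
      (hmeas2.mul (hf.comp measurable_snd)).stronglyMeasurable
    exact (this.integral_prod_right (ν := ν)).measurable
  have hBb : ∀ ξ, ‖B ξ‖ ≤ L * ν.real univ := by
    intro ξ
    apply norm_integral_le_of_norm_le_const
    filter_upwards [hL] with p hp
    rw [norm_mul, Circle.norm_coe, one_mul]; exact hp
  set a := ∫⁻ p, ‖f p‖ₑ ^ (2:ℝ) ∂ν with ha
  have key : ∀ n : ℕ, ∫⁻ ξ in Metric.ball (0:V) n, ‖B ξ‖ₑ ^ (2:ℝ) ≤ M * a := by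
    intro n
    set D := Metric.ball (0:V) n with hD
    have hDm : MeasurableSet D := measurableSet_ball
    have hDfin : volume D ≠ ∞ := measure_ball_lt_top.ne
    set h : V → ℂ := D.indicator (fun ξ => conj (B ξ)) with hh
    have hhm : Measurable h := (Complex.continuous_conj.measurable.comp hBm).indicator hDm
    have htop : MemLp h ∞ := by
      apply memLp_top_of_bound hhm.aestronglyMeasurable (L * ν.real univ)
      filter_upwards with ξ
      by_cases hx : ξ ∈ D
      · simpa [hh, hx] using hBb ξ
      · simp only [hh, hx, not_false_eq_true, indicator_of_notMem, norm_zero]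
        exact (norm_nonneg _).trans (hBb 0)
    have hp : ∀ p : ℝ≥0∞, MemLp h p := fun p =>
      htop.mono_exponent_of_measure_support_ne_top (s := D) (fun x hx => by simp [hh, hx]) hDfin le_top
    have h1 : Integrable h := memLp_one_iff_integrable.1 (hp 1)
    have pl := plancherel_L1L2 h h1 (hp 2)
    have hFm : Measurable (𝓕 h) := by
      have : Continuous (𝓕 h) :=
        VectorFourier.fourierIntegral_continuous Real.continuous_fourierChar
          (by exact continuous_inner) h1
      exact this.measurable
    set I := ∫⁻ ξ in D, ‖B ξ‖ₑ ^ (2:ℝ) with hI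
    have hIh : ∫⁻ ξ, ‖h ξ‖ₑ ^ (2:ℝ) = I := by
      rw [hI, ← lintegral_indicator hDm]
      congr 1; ext ξ
      by_cases hx : ξ ∈ D
      · simp [hh, hx]
      · simp [hh, hx]
    have pl2 : ∫⁻ ξ, ‖𝓕 h ξ‖ₑ ^ (2:ℝ) = I := by
      rw [← hIh]
      rw [eLpNorm_eq_lintegral_rpow_enorm_toReal (by norm_num) (by norm_num),
        eLpNorm_eq_lintegral_rpow_enorm_toReal (by norm_num) (by norm_num)] at pl
      simp only [ENNReal.toReal_ofNat] at pl
      exact (ENNReal.rpow_left_injective (by norm_num : (1/2:ℝ) ≠ 0)) pl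
    have hIfin : I ≠ ∞ := by
      rw [← hIh]
      have := (hp 2).2
      rw [eLpNorm_lt_top_iff_lintegral_rpow_enorm_lt_top (by norm_num) (by norm_num)] at this
      simpa using this.ne
    -- duality
    have dual : (∫ ξ, B ξ * h ξ) = ∫ p, f p * 𝓕 h (Φ p) ∂ν := by
      have : ∀ ξ, B ξ * h ξ = ∫ p, (𝐞 (-⟪Φ p, ξ⟫_ℝ) : ℂ) * f p * h ξ ∂ν := fun ξ =>
        (integral_mul_const _ _).symm
      simp_rw [this]
      rw [integral_integral_swap]
      · congr 1; ext p
        rw [Real.fourier_eq, ← integral_const_mul]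
        congr 1; ext ξ
        rw [Circle.smul_def, real_inner_comm]
        simp only [smul_eq_mul]; ring
      · have hg : Integrable (fun z : V × X => h z.1 * f z.2) ((volume : Measure V).prod ν) := by
          apply h1.mul_prod
          exact Integrable.of_bound hf.aestronglyMeasurable L hL
        refine hg.mono ?_ ?_
        · exact ((hmeas2.mul (hf.comp measurable_snd)).mul
            (hhm.comp measurable_fst)).aestronglyMeasurable
        · filter_upwards with z
          simp only [Function.uncurry, norm_mul, Circle.norm_coe, one_mul]; rw [mul_comm]
    have dual2 : ∫ ξ, B ξ * h ξ = ((∫ ξ in D, ‖B ξ‖ ^ 2 : ℝ) : ℂ) := by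
      rw [← integral_complex_ofReal, ← integral_indicator hDm]
      congr 1; ext ξ
      by_cases hx : ξ ∈ D
      · simp [hh, hx, Complex.mul_conj, Complex.normSq_eq_norm_sq]
      · simp [hh, hx]
    have e1 : I = ‖∫ ξ, B ξ * h ξ‖ₑ := by
      rw [dual2, ← ofReal_norm, Complex.norm_real, Real.norm_of_nonneg (by positivity),
        ofReal_integral_eq_lintegral_ofReal]
      · rw [hI]; refine lintegral_congr fun ξ => ?_
        rw [← ofReal_norm, ENNReal.ofReal_rpow_of_nonneg (norm_nonneg _) (by norm_num)]
        norm_num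
      · have : IsFiniteMeasure (volume.restrict D) := ⟨by simpa using hDfin.lt_top⟩
        refine Integrable.of_bound (hBm.norm.pow_const 2).aestronglyMeasurable ((L * ν.real univ)^2) ?_
        · filter_upwards with ξ
          rw [norm_pow, norm_norm]
          gcongr; exact hBb ξ
      · filter_upwards with ξ
        positivity
    have e2 : I ≤ a ^ (1/2:ℝ) * (M * I) ^ (1/2:ℝ) := by
      calc I = ‖∫ p, f p * 𝓕 h (Φ p) ∂ν‖ₑ := by rw [e1, dual]
        _ ≤ ∫⁻ p, ‖f p * 𝓕 h (Φ p)‖ₑ ∂ν := enorm_integral_le_lintegral_enorm _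
        _ = ∫⁻ p, (‖f p‖ₑ ^ (2:ℝ)) ^ (1/2:ℝ) * (‖𝓕 h (Φ p)‖ₑ ^ (2:ℝ)) ^ (1/2:ℝ) ∂ν := by
          congr 1; ext p
          rw [← ENNReal.rpow_mul, ← ENNReal.rpow_mul]; norm_num
        _ ≤ (∫⁻ p, ‖f p‖ₑ ^ (2:ℝ) ∂ν) ^ (1/2:ℝ) * (∫⁻ p, ‖𝓕 h (Φ p)‖ₑ ^ (2:ℝ) ∂ν) ^ (1/2:ℝ) := by
          apply ENNReal.lintegral_mul_norm_pow_le
          · fun_prop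
          · exact ((hFm.comp hΦ).enorm.pow_const _).aemeasurable
          all_goals norm_num
        _ ≤ _ := by
          gcongr
          rw [← lintegral_map (f := fun v => ‖𝓕 h v‖ₑ ^ (2:ℝ)) (hFm.enorm.pow_const _) hΦ, ← pl2]
          calc _ ≤ ∫⁻ v, ‖𝓕 h v‖ₑ ^ (2:ℝ) ∂(M • (volume : Measure V)) := lintegral_mono' hν le_rfl
            _ = _ := lintegral_smul_measure _ _
    by_cases hI0 : I = 0
    · simp [hI0]
    have e3 : I * I ≤ (M * a) * I := by
      rw [← ENNReal.mul_rpow_of_nonneg _ _ (by norm_num)] at e2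
      have := ENNReal.rpow_le_rpow e2 (by norm_num : (0:ℝ) ≤ 2)
      rw [← ENNReal.rpow_mul] at this
      norm_num at this
      calc I * I = I ^ 2 := (sq I).symm
        _ ≤ _ := this
        _ = _ := by ring
    exact (ENNReal.mul_le_mul_iff_left hI0 hIfin).1 e3
  have hU : (⋃ n : ℕ, Metric.ball (0:V) n) = univ := Metric.iUnion_ball_nat 0
  rw [← setLIntegral_univ, ← hU, setLIntegral_iUnion_of_directed]
  · exact iSup_le key
  · exact (monotone_nat_of_le_succ fun n => Metric.ball_subset_ball (by simp)).directed_le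


open scoped FourierTransform InnerProductSpace in
theorem ext_L2' {V : Type*} [NormedAddCommGroup V] [InnerProductSpace ℝ V]
    [FiniteDimensional ℝ V] [MeasurableSpace V] [BorelSpace V] : ∃ K : ℝ≥0∞, K ≠ ∞ ∧ 
    ∀ {X : Type} [MeasurableSpace X] (ν : Measure X) [IsFiniteMeasure ν]
    (Φ : X → V) (_ : Measurable Φ) (M : ℝ≥0∞)
    (_ : ν.map Φ ≤ M • (volume : Measure V)) (f : X → ℂ) (_ : Measurable f) (L : ℝ)
    (_ : ∀ᵐ p ∂ν, ‖f p‖ ≤ L),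
    ∫⁻ ξ : V, ‖∫ p, Complex.exp (Complex.I * ((⟪Φ p, ξ⟫_ℝ : ℝ) : ℂ)) * f p ∂ν‖ₑ ^ (2:ℝ) ≤
      K * (M * ∫⁻ p, ‖f p‖ₑ ^ (2:ℝ) ∂ν) := by
  have hpi : (-(2 * π)) ≠ 0 := by have := Real.pi_pos; intro h; linarith
  refine ⟨ENNReal.ofReal (|((-(2*π)) ^ Module.finrank ℝ V)⁻¹|⁻¹), ENNReal.ofReal_ne_top, ?_⟩
  intro X _ ν _ Φ hΦ M hν f hf L hL
  have h := ext_L2 ν Φ hΦ M hν f hf L hL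
  set g : V → ℝ≥0∞ := fun ξ => ‖∫ p, Complex.exp (Complex.I * ((⟪Φ p, ξ⟫_ℝ : ℝ) : ℂ)) * f p ∂ν‖ₑ ^ (2:ℝ) with hg
  have hg2 : ∀ ξ, ‖∫ p, (𝐞 (-⟪Φ p, ξ⟫_ℝ) : ℂ) * f p ∂ν‖ₑ ^ (2:ℝ) = g ((-(2*π)) • ξ) := by
    intro ξ
    simp only [hg]
    congr 3
    ext p
    rw [Real.fourierChar_apply, inner_smul_right]
    congr 2
    push_cast; ring
  simp_rw [hg2] at h
  have e := Measure.map_addHaar_smul (volume : Measure V) hpi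
  have emb := (Homeomorph.smulOfNeZero (-(2*π)) hpi (α := V)).toMeasurableEquiv.measurableEmbedding
  have h3 : ∫⁻ ξ, g ((-(2*π)) • ξ) = ENNReal.ofReal |((-(2*π)) ^ Module.finrank ℝ V)⁻¹| * ∫⁻ ξ, g ξ := by
    have := lintegral_smul_measure (μ := (volume : Measure V)) (ENNReal.ofReal |((-(2*π)) ^ Module.finrank ℝ V)⁻¹|) g
    rw [smul_eq_mul] at this
    rw [← this, ← e]
    exact (emb.lintegral_map g).symm
  rw [h3] at h
  set c := |((-(2*π)) ^ Module.finrank ℝ V)⁻¹| with hc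
  have hc0 : 0 < c := by
    rw [hc, abs_pos]; exact inv_ne_zero (pow_ne_zero _ hpi)
  calc ∫⁻ ξ, g ξ = ENNReal.ofReal c⁻¹ * (ENNReal.ofReal c * ∫⁻ ξ, g ξ) := by
        rw [← mul_assoc, ← ENNReal.ofReal_mul (by positivity), inv_mul_cancel₀ hc0.ne']; simp
    _ ≤ _ := by gcongr

theorem ext_line : ∃ K : ℝ≥0∞, K ≠ ∞ ∧ 
    ∀ {X : Type} [MeasurableSpace X] (ν : Measure X) [IsFiniteMeasure ν]
    (Φ : X → ℝ) (_ : Measurable Φ) (M : ℝ≥0∞)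
    (_ : ν.map Φ ≤ M • (volume : Measure ℝ)) (f : X → ℂ) (_ : Measurable f) (L : ℝ)
    (_ : ∀ᵐ p ∂ν, ‖f p‖ ≤ L),
    ∫⁻ y : ℝ, ‖∫ p, Complex.exp (Complex.I * ((y * Φ p : ℝ) : ℂ)) * f p ∂ν‖ₑ ^ (2:ℝ) ≤
      K * (M * ∫⁻ p, ‖f p‖ₑ ^ (2:ℝ) ∂ν) := by
  obtain ⟨K, hK, h⟩ := ext_L2' (V := ℝ)
  exact ⟨K, hK, fun ν _ Φ hΦ M hM f hf L hL => h ν Φ hΦ M hM f hf L hL⟩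

theorem ext_plane : ∃ K : ℝ≥0∞, K ≠ ∞ ∧ 
    ∀ {X : Type} [MeasurableSpace X] (ν : Measure X) [IsFiniteMeasure ν]
    (Φ : X → ℝ × ℝ) (_ : Measurable Φ) (M : ℝ≥0∞)
    (_ : ν.map Φ ≤ M • (volume : Measure (ℝ × ℝ))) (f : X → ℂ) (_ : Measurable f) (L : ℝ)
    (_ : ∀ᵐ p ∂ν, ‖f p‖ ≤ L),
    ∫⁻ z : ℝ × ℝ, ‖∫ p, Complex.exp (Complex.I * ((z.1 * (Φ p).1 + z.2 * (Φ p).2 : ℝ) : ℂ)) * f p ∂ν‖ₑ ^ (2:ℝ) ≤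
      K * (M * ∫⁻ p, ‖f p‖ₑ ^ (2:ℝ) ∂ν) := by
  obtain ⟨K, hK, h⟩ := ext_L2' (V := ℂ)
  refine ⟨K, hK, fun ν _ Φ hΦ M hM f hf L hL => ?_⟩
  set e := Complex.measurableEquivRealProd with he
  have hmp := Complex.volume_preserving_equiv_real_prod
  have := h ν (fun p => e.symm (Φ p)) (e.symm.measurable.comp hΦ) M ?_ f hf L hL
  · rw [← hmp.lintegral_comp_emb e.measurableEmbedding]
    refine le_trans (le_of_eq ?_) this
    refine lintegral_congr fun ξ => ?_
    congr 3
    ext p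
    congr 3
    rw [Complex.inner]
    simp [he, Complex.measurableEquivRealProd]
  · have e1 : ν.map (fun p => e.symm (Φ p)) = (ν.map Φ).map e.symm := 
      (Measure.map_map e.symm.measurable hΦ).symm
    rw [e1, ← (hmp.symm e).map_eq, ← Measure.map_smul]
    exact Measure.map_mono hM e.symm.measurable


theorem map_le_of_inj {E : Type*} [NormedAddCommGroup E] [NormedSpace ℝ E] [FiniteDimensional ℝ E]
    [MeasurableSpace E] [BorelSpace E] (μ : Measure E) [μ.IsAddHaarMeasure]
    (s : Set E) (hs : MeasurableSet s) (f : E → E) (hfm : Measurable f) (f' : E → E →L[ℝ] E)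
    (hf' : ∀ x ∈ s, HasFDerivAt f (f' x) x) (hinj : InjOn f s) (c : ℝ) (hc : 0 < c)
    (hdet : ∀ x ∈ s, c ≤ |(f' x).det|) :
    (μ.restrict s).map f ≤ ENNReal.ofReal c⁻¹ • μ := by
  rw [Measure.le_iff]
  intro A hA
  rw [Measure.map_apply hfm hA, ← lintegral_indicator_one (hfm hA)]
  have h := lintegral_image_eq_lintegral_abs_det_fderiv_mul μ hs
    (fun x hx => (hf' x hx).hasFDerivWithinAt) hinj (A.indicator 1)
  calc ∫⁻ x in s, (f ⁻¹' A).indicator 1 x ∂μ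
      ≤ ∫⁻ x in s, ENNReal.ofReal c⁻¹ * (ENNReal.ofReal |(f' x).det| * A.indicator 1 (f x)) ∂μ := by
        apply setLIntegral_mono_ae' hs
        filter_upwards with x hx
        by_cases hxA : f x ∈ A
        · simp only [mem_preimage, hxA, indicator_of_mem, Pi.one_apply, mul_one]
          rw [← ENNReal.ofReal_mul (by positivity), ENNReal.one_le_ofReal]
          rw [inv_mul_eq_div, le_div_iff₀ hc]; simpa using hdet x hx
        · simp [hxA]
    _ = ENNReal.ofReal c⁻¹ * ∫⁻ x in f '' s, A.indicator 1 x ∂μ := by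
        rw [h, lintegral_const_mul' _ _ ENNReal.ofReal_ne_top]
    _ ≤ ENNReal.ofReal c⁻¹ * ∫⁻ x, A.indicator 1 x ∂μ := by
        gcongr; exact Measure.restrict_le_self
    _ = _ := by rw [lintegral_indicator_one hA]; rfl

def sumMap (p : ℝ × ℝ) : ℝ × ℝ := (cos p.1 + cos p.2, sin p.1 + sin p.2)

def sumMap' (p : ℝ × ℝ) : ℝ × ℝ →L[ℝ] ℝ × ℝ :=
  (Matrix.toLin (.finTwoProd ℝ) (.finTwoProd ℝ)
    !![-sin p.1, -sin p.2; cos p.1, cos p.2]).toContinuousLinearMap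

theorem sumMap_deriv (p : ℝ × ℝ) : HasFDerivAt sumMap (sumMap' p) p := by
  unfold sumMap'
  rw [Matrix.toLin_finTwoProd_toContinuousLinearMap]
  exact HasFDerivAt.prodMk (𝕜 := ℝ)
      (((hasDerivAt_cos p.1).comp_hasFDerivAt p hasFDerivAt_fst).add ((hasDerivAt_cos p.2).comp_hasFDerivAt p hasFDerivAt_snd))
      (((hasDerivAt_sin p.1).comp_hasFDerivAt p hasFDerivAt_fst).add ((hasDerivAt_sin p.2).comp_hasFDerivAt p hasFDerivAt_snd))

theorem sumMap_det (p : ℝ × ℝ) : (sumMap' p).det = sin (p.2 - p.1) := by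
  unfold sumMap'
  simp only [LinearMap.det_toContinuousLinearMap, LinearMap.det_toLin,
    Matrix.det_fin_two_of, Real.sin_sub]
  ring

theorem sumMap_inj (c : ℝ) :
    InjOn sumMap {p | p.1 ∈ Ioc c (c + π/2) ∧ p.2 ∈ Ioc c (c + π/2) ∧ p.1 < p.2} := by
  rintro ⟨a, b⟩ ⟨⟨ha1, ha2⟩, ⟨hb1, hb2⟩, hab⟩ ⟨a', b'⟩ ⟨⟨ha1', ha2'⟩, ⟨hb1', hb2'⟩, hab'⟩ h
  simp only [sumMap, Prod.mk.injEq] at *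
  obtain ⟨h1, h2⟩ := h
  have hpi := Real.pi_pos
  have e1 : cos a + cos b = 2 * cos ((a+b)/2) * cos ((b-a)/2) := by
    rw [Real.cos_add_cos, ← Real.cos_neg ((b-a)/2)]; ring_nf
  have e2 : sin a + sin b = 2 * sin ((a+b)/2) * cos ((b-a)/2) := by
    have h3 : a = (a+b)/2 - (b-a)/2 := by ring
    have h4 : b = (a+b)/2 + (b-a)/2 := by ring
    conv_lhs => rw [h3, h4, Real.sin_add, Real.sin_sub]
    ring_nf
  have e1' : cos a' + cos b' = 2 * cos ((a'+b')/2) * cos ((b'-a')/2) := by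
    rw [Real.cos_add_cos, ← Real.cos_neg ((b'-a')/2)]; ring_nf
  have e2' : sin a' + sin b' = 2 * sin ((a'+b')/2) * cos ((b'-a')/2) := by
    have h3 : a' = (a'+b')/2 - (b'-a')/2 := by ring
    have h4 : b' = (a'+b')/2 + (b'-a')/2 := by ring
    conv_lhs => rw [h3, h4, Real.sin_add, Real.sin_sub]
    ring_nf
  rw [e1, e1'] at h1
  rw [e2, e2'] at h2
  have hd : 0 < cos ((b-a)/2) := Real.cos_pos_of_mem_Ioo ⟨by linarith, by linarith⟩
  have hd' : 0 < cos ((b'-a')/2) := Real.cos_pos_of_mem_Ioo ⟨by linarith, by linarith⟩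
  have hcc : cos ((b-a)/2) = cos ((b'-a')/2) := by
    have hs := Real.sin_sq_add_cos_sq ((a+b)/2)
    have hs' := Real.sin_sq_add_cos_sq ((a'+b')/2)
    have : cos ((b-a)/2)^2 = cos ((b'-a')/2)^2 := by
      have l : cos ((b-a)/2)^2 = (cos ((a+b)/2) * cos ((b-a)/2))^2 + (sin ((a+b)/2) * cos ((b-a)/2))^2 := by
        linear_combination (-cos ((b-a)/2)^2) * hs
      have l' : cos ((b'-a')/2)^2 = (cos ((a'+b')/2) * cos ((b'-a')/2))^2 + (sin ((a'+b')/2) * cos ((b'-a')/2))^2 := by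
        linear_combination (-cos ((b'-a')/2)^2) * hs'
      have m1 : cos ((a+b)/2) * cos ((b-a)/2) = cos ((a'+b')/2) * cos ((b'-a')/2) := by linarith
      have m2 : sin ((a+b)/2) * cos ((b-a)/2) = sin ((a'+b')/2) * cos ((b'-a')/2) := by linarith
      rw [l, l', m1, m2]
    exact (pow_left_inj₀ hd.le hd'.le two_ne_zero).1 this
  have hdd : (b-a)/2 = (b'-a')/2 :=
    Real.injOn_cos ⟨by linarith, by linarith⟩ ⟨by linarith, by linarith⟩ hcc
  rw [hcc] at h1 h2
  have n1 : cos ((a+b)/2) = cos ((a'+b')/2) := by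
    have := mul_right_cancel₀ hd'.ne' h1; linarith
  have n2 : sin ((a+b)/2) = sin ((a'+b')/2) := by
    have := mul_right_cancel₀ hd'.ne' h2; linarith
  have n3 : cos ((a+b)/2 - (a'+b')/2) = 1 := by
    rw [Real.cos_sub, n1, n2]
    have := Real.sin_sq_add_cos_sq ((a'+b')/2); linarith
  have n4 := (Real.cos_eq_one_iff_of_lt_of_lt (by linarith) (by linarith)).1 n3
  constructor <;> linarith

theorem sumMap_meas : Measurable sumMap := by
  unfold sumMap; fun_prop

theorem sumMap_map (c δ : ℝ) (hδ : 0 < δ) (D : Set (ℝ × ℝ)) (hD : MeasurableSet D)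
    (hD2 : ∀ p ∈ D, p.1 ∈ Ioc c (c + π/2) ∧ p.2 ∈ Ioc c (c + π/2) ∧ δ < p.2 - p.1) :
    ((volume : Measure (ℝ × ℝ)).restrict D).map sumMap ≤ ENNReal.ofReal (2/π*δ)⁻¹ • volume := by
  have hpi := Real.pi_pos
  apply map_le_of_inj _ D hD sumMap sumMap_meas sumMap' (fun x _ => sumMap_deriv x)
  · apply (sumMap_inj c).mono
    intro p hp
    obtain ⟨h1, h2, h3⟩ := hD2 p hp
    exact ⟨h1, h2, by linarith⟩
  · positivity
  · intro p hp
    obtain ⟨⟨_, _⟩, ⟨_, _⟩, h3⟩ := hD2 p hp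
    rw [sumMap_det]
    have : 2/π * (p.2 - p.1) ≤ sin (p.2 - p.1) := Real.mul_le_sin (by linarith) (by linarith)
    refine le_trans ?_ (le_abs_self _)
    refine le_trans ?_ this
    gcongr

theorem sin_map (i : ℕ) (hi : i < 4) (δ : ℝ) (hδ : 0 < δ) (S : Set ℝ) (hS : MeasurableSet S)
    (hS2 : S ⊆ Ioc (i * (π/2)) (i * (π/2) + π/2)) (hS3 : ∀ x ∈ S, δ < |cos x|) :
    ((volume : Measure ℝ).restrict S).map sin ≤ ENNReal.ofReal δ⁻¹ • volume := by
  have hpi := Real.pi_pos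
  apply map_le_of_inj _ S hS sin Real.measurable_sin _ (fun x _ => (Real.hasDerivAt_sin x).hasFDerivAt)
  · intro x hx y hy hxy
    obtain ⟨x1, x2⟩ := hS2 hx
    obtain ⟨y1, y2⟩ := hS2 hy
    interval_cases i <;> norm_num at x1 x2 y1 y2
    · exact Real.injOn_sin ⟨by linarith, by linarith⟩ ⟨by linarith, by linarith⟩ hxy
    · have : x - π = y - π := Real.injOn_sin ⟨by linarith, by linarith⟩ ⟨by linarith, by linarith⟩
        (by rw [Real.sin_sub_pi, Real.sin_sub_pi, hxy])
      linarith
    · have : x - π = y - π := Real.injOn_sin ⟨by linarith, by linarith⟩ ⟨by linarith, by linarith⟩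
        (by rw [Real.sin_sub_pi, Real.sin_sub_pi, hxy])
      linarith
    · have : x - 2 * π = y - 2 * π := Real.injOn_sin ⟨by linarith, by linarith⟩ ⟨by linarith, by linarith⟩
        (by rw [Real.sin_sub_two_pi, Real.sin_sub_two_pi, hxy])
      linarith
  · exact hδ
  · intro x hx
    rw [ContinuousLinearMap.det_toSpanSingleton]
    exact (hS3 x hx).le

theorem cos_small (i : ℕ) (hi : i < 4) (t : ℝ) (S : Set ℝ)
    (hS2 : S ⊆ Ioc (i * (π/2)) (i * (π/2) + π/2)) (hS3 : ∀ x ∈ S, |cos x| ≤ t) :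
    volume S ≤ ENNReal.ofReal (π * t) := by
  have hpi := Real.pi_pos
  have main : ∀ c : ℝ, (∀ x, |sin (x - c)| = |cos x|) → (∀ x ∈ S, |x - c| ≤ π/2) →
      volume S ≤ ENNReal.ofReal (π * t) := by
    intro c h1 h2
    calc volume S ≤ volume (Icc (c - π/2*t) (c + π/2*t)) := by
          apply measure_mono
          intro x hx
          have := Real.mul_abs_le_abs_sin (h2 x hx)
          rw [h1] at this
          have h4 := this.trans (hS3 x hx)
          have h5 : |x - c| ≤ π/2*t := by
            have : |x - c| = π/2 * (2/π*|x-c|) := by field_simp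
            rw [this]; gcongr
          rw [abs_le] at h5
          exact ⟨by linarith, by linarith⟩
      _ = _ := by rw [Real.volume_Icc]; congr 1; ring
  have hA : ∀ x, |sin (x - π/2)| = |cos x| := by intro x; rw [Real.sin_sub_pi_div_two, abs_neg]
  have hB : ∀ x, |sin (x - 3*(π/2))| = |cos x| := by
    intro x
    have : x - 3*(π/2) = x - π/2 - π := by ring
    rw [this, Real.sin_sub_pi, abs_neg, hA]
  interval_cases i
  · refine main _ hA fun x hx => ?_
    obtain ⟨x1, x2⟩ := hS2 hx
    norm_num at x1 x2
    rw [abs_le]; constructor <;> linarith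
  · refine main _ hA fun x hx => ?_
    obtain ⟨x1, x2⟩ := hS2 hx
    norm_num at x1 x2
    rw [abs_le]; constructor <;> linarith
  · refine main _ hB fun x hx => ?_
    obtain ⟨x1, x2⟩ := hS2 hx
    norm_num at x1 x2
    rw [abs_le]; constructor <;> linarith
  · refine main _ hB fun x hx => ?_
    obtain ⟨x1, x2⟩ := hS2 hx
    norm_num at x1 x2
    rw [abs_le]; constructor <;> linarith


theorem mink_fin {X ι : Type*} [MeasurableSpace X] (μ : Measure X) (p : ℝ) (hp : 1 ≤ p)
    (f : ι → X → ℝ≥0∞) (hf : ∀ i, Measurable (f i)) (s : Finset ι) :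
    (∫⁻ x, (∑ i ∈ s, f i x) ^ p ∂μ) ^ (1/p) ≤ ∑ i ∈ s, (∫⁻ x, f i x ^ p ∂μ) ^ (1/p) := by
  classical
  induction s using Finset.induction_on with
  | empty =>
    have : 0 < p := by linarith
    simp [this]
  | insert a s ha ih =>
    simp only [Finset.sum_insert ha]
    refine le_trans ?_ (add_le_add le_rfl ih)
    exact ENNReal.lintegral_Lp_add_le (f := f a) (g := fun x => ∑ i ∈ s, f i x) (hf a).aemeasurable
      (by fun_prop) hp

theorem mink {X ι : Type*} [MeasurableSpace X] [Countable ι] (μ : Measure X) (p : ℝ) (hp : 1 ≤ p)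
    (f : ι → X → ℝ≥0∞) (hf : ∀ i, Measurable (f i)) :
    (∫⁻ x, (∑' i, f i x) ^ p ∂μ) ^ (1/p) ≤ ∑' i, (∫⁻ x, f i x ^ p ∂μ) ^ (1/p) := by
  have hp0 : 0 < p := by linarith
  have e1 : ∀ x, (∑' i, f i x) ^ p = ⨆ s : Finset ι, (∑ i ∈ s, f i x) ^ p := by
    intro x
    rw [ENNReal.tsum_eq_iSup_sum]
    exact (ENNReal.orderIsoRpow p hp0).map_iSup _
  simp_rw [e1]
  rw [lintegral_iSup_directed]
  · have := (ENNReal.orderIsoRpow (1/p) (by positivity)).map_iSup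
      (fun s : Finset ι => ∫⁻ x, (∑ i ∈ s, f i x) ^ p ∂μ)
    simp only [ENNReal.orderIsoRpow_apply] at this
    rw [this]
    exact iSup_le fun s => (mink_fin μ p hp f hf s).trans (ENNReal.sum_le_tsum s)
  · intro s; fun_prop
  · refine Monotone.directed_le fun s t hst x => ?_
    dsimp only
    gcongr

def T (F : ℝ → ℂ) (S : Set ℝ) (z : ℝ × ℝ) : ℂ :=
  ∫ φ in S, Complex.exp (Complex.I * ((z.1 * cos φ + z.2 * sin φ : ℝ) : ℂ)) * F φ

theorem T_meas (F : ℝ → ℂ) (hF : Measurable F) (S : Set ℝ) : Measurable (T F S) := by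
  have : StronglyMeasurable (fun w : (ℝ × ℝ) × ℝ =>
      Complex.exp (Complex.I * ((w.1.1 * cos w.2 + w.1.2 * sin w.2 : ℝ) : ℂ)) * F w.2) := by
    apply Measurable.stronglyMeasurable
    fun_prop
  exact (this.integral_prod_right (ν := volume.restrict S)).measurable

theorem norm_expI (t : ℝ) : ‖Complex.exp (Complex.I * (t : ℂ))‖ = 1 := by
  rw [mul_comm]; exact Complex.norm_exp_ofReal_mul_I t

theorem T_line : ∃ K : ℝ≥0∞, K ≠ ∞ ∧ ∀ (i : ℕ) (_ : i < 4) (δ : ℝ) (_ : 0 < δ) (S : Set ℝ)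
    (_ : MeasurableSet S) (_ : S ⊆ Ioc (i * (π/2)) (i * (π/2) + π/2)) (_ : ∀ x ∈ S, δ < |cos x|)
    (F : ℝ → ℂ) (_ : Measurable F) (L : ℝ) (_ : ∀ x ∈ S, ‖F x‖ ≤ L) (x : ℝ),
    ∫⁻ y, ‖T F S (x, y)‖ₑ ^ (2:ℝ) ≤
      K * (ENNReal.ofReal δ⁻¹ * (ENNReal.ofReal L ^ (2:ℝ) * volume S)) := by
  obtain ⟨K, hK, h⟩ := ext_line
  refine ⟨K, hK, fun i hi δ hδ S hS hS2 hS3 F hF L hL x => ?_⟩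
  have hfin : volume S < ∞ := (measure_mono hS2).trans_lt (by simp)
  have : IsFiniteMeasure (volume.restrict S) := ⟨by simpa using hfin⟩
  have hb : ∀ φ ∈ S, ‖Complex.exp (Complex.I * ((x * cos φ : ℝ) : ℂ)) * F φ‖ ≤ L := by
    intro φ hφ
    rw [norm_mul, norm_expI, one_mul]; exact hL φ hφ
  have := h (volume.restrict S) sin Real.measurable_sin _ (sin_map i hi δ hδ S hS hS2 hS3)
    (fun φ => Complex.exp (Complex.I * ((x * cos φ : ℝ) : ℂ)) * F φ) (by fun_prop) L
    ((ae_restrict_iff' hS).2 (Eventually.of_forall hb))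
  refine le_trans (le_of_eq ?_) (this.trans ?_)
  · refine lintegral_congr fun y => ?_
    simp only [T]
    congr 3
    ext φ
    rw [← mul_assoc, ← Complex.exp_add]
    congr 2
    push_cast; ring
  · gcongr
    calc _ ≤ ∫⁻ φ in S, ENNReal.ofReal L ^ (2:ℝ) := by
          apply setLIntegral_mono_ae' hS
          filter_upwards with φ hφ
          gcongr
          rw [← ofReal_norm]
          exact ENNReal.ofReal_le_ofReal (hb φ hφ)
      _ = _ := by simp


def Dj (S : Set ℝ) (j : ℕ) : Set (ℝ × ℝ) :=
  {q | q.1 ∈ S ∧ q.2 ∈ S ∧ (1/2:ℝ)^j < q.2 - q.1 ∧ q.2 - q.1 ≤ 2 * (1/2:ℝ)^j}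

theorem Dj_meas (S : Set ℝ) (hS : MeasurableSet S) (j : ℕ) : MeasurableSet (Dj S j) := by
  have h1 : MeasurableSet {q : ℝ × ℝ | q.1 ∈ S} := measurable_fst hS
  have h2 : MeasurableSet {q : ℝ × ℝ | q.2 ∈ S} := measurable_snd hS
  have h3 : MeasurableSet {q : ℝ × ℝ | (1/2:ℝ)^j < q.2 - q.1} :=
    measurableSet_lt (by fun_prop) (by fun_prop)
  have h4 : MeasurableSet {q : ℝ × ℝ | q.2 - q.1 ≤ 2 * (1/2:ℝ)^j} :=
    measurableSet_le (by fun_prop) (by fun_prop)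
  exact h1.inter (h2.inter (h3.inter h4))

theorem Dj_vol (S : Set ℝ) (hS : MeasurableSet S) (j : ℕ) :
    volume (Dj S j) ≤ volume S * min (volume S) (2 * ENNReal.ofReal ((1/2:ℝ)^j)) := by
  rw [Measure.volume_eq_prod, Measure.prod_apply (Dj_meas S hS j)]
  calc _ ≤ ∫⁻ x, S.indicator (fun _ => min (volume S) (2 * ENNReal.ofReal ((1/2:ℝ)^j))) x := by
        refine lintegral_mono fun x => ?_
        by_cases hx : x ∈ S
        · simp only [hx, indicator_of_mem]
          apply le_min
          · exact measure_mono fun y hy => hy.2.1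
          · calc _ ≤ volume (Ioc (x + (1/2:ℝ)^j) (x + 2 * (1/2:ℝ)^j)) := by
                  apply measure_mono
                  intro y hy
                  obtain ⟨_, _, h3, h4⟩ := hy
                  simp only at h3 h4
                  exact ⟨by linarith, by linarith⟩
              _ = ENNReal.ofReal ((1/2:ℝ)^j) := by rw [Real.volume_Ioc]; congr 1; ring
              _ ≤ _ := by rw [two_mul]; exact le_self_add
        · have : (Prod.mk x ⁻¹' Dj S j) = ∅ := by
            ext y; simp [Dj, hx]
          simp [this]
    _ = _ := by rw [lintegral_indicator_const hS, mul_comm]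

def Bj (F : ℝ → ℂ) (D : Set (ℝ × ℝ)) (z : ℝ × ℝ) : ℂ :=
  ∫ q in D, Complex.exp (Complex.I * ((z.1 * (sumMap q).1 + z.2 * (sumMap q).2 : ℝ) : ℂ)) *
    (F q.1 * F q.2)

theorem Bj_meas (F : ℝ → ℂ) (hF : Measurable F) (D : Set (ℝ × ℝ)) : Measurable (Bj F D) := by
  have : StronglyMeasurable (fun w : (ℝ × ℝ) × (ℝ × ℝ) =>
      Complex.exp (Complex.I * ((w.1.1 * (sumMap w.2).1 + w.1.2 * (sumMap w.2).2 : ℝ) : ℂ)) *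
    (F w.2.1 * F w.2.2)) := by
    apply Measurable.stronglyMeasurable
    have := sumMap_meas
    fun_prop
  exact (this.integral_prod_right (ν := volume.restrict D)).measurable

theorem Bj_L2 : ∃ K : ℝ≥0∞, K ≠ ∞ ∧ ∀ (c : ℝ) (S : Set ℝ)
    (_ : MeasurableSet S) (_ : S ⊆ Ioc c (c + π/2)) 
    (F : ℝ → ℂ) (_ : Measurable F) (L : ℝ) (_ : 0 ≤ L) (_ : ∀ x ∈ S, ‖F x‖ ≤ L) (j : ℕ),
    (∀ z, ‖Bj F (Dj S j) z‖ₑ ≤ ENNReal.ofReal L ^ (2:ℝ) * volume (Dj S j)) ∧ 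
    ∫⁻ z, ‖Bj F (Dj S j) z‖ₑ ^ (2:ℝ) ≤
      K * ((ENNReal.ofReal ((1/2:ℝ)^j))⁻¹ * ((ENNReal.ofReal L ^ (2:ℝ)) ^ (2:ℝ) * volume (Dj S j))) := by
  obtain ⟨K, hK, h⟩ := ext_plane
  have hpi := Real.pi_pos
  refine ⟨K * ENNReal.ofReal (π/2), ENNReal.mul_ne_top hK ENNReal.ofReal_ne_top, fun c S hS hS2 F hF L hL0 hL j => ?_⟩
  have hfin : volume S < ∞ := (measure_mono hS2).trans_lt (by simp)
  have hDm := Dj_meas S hS j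
  have hfin2 : volume (Dj S j) < ∞ := by
    refine (Dj_vol S hS j).trans_lt (ENNReal.mul_lt_top hfin ?_)
    exact (min_le_left _ _).trans_lt hfin
  have : IsFiniteMeasure (volume.restrict (Dj S j)) := ⟨by simpa using hfin2⟩
  have hb : ∀ q ∈ Dj S j, ‖F q.1 * F q.2‖ ≤ L ^ 2 := by
    intro q hq
    rw [norm_mul, sq]
    exact mul_le_mul (hL _ hq.1) (hL _ hq.2.1) (norm_nonneg _) hL0
  have hbe : ∀ q ∈ Dj S j, ‖F q.1 * F q.2‖ₑ ≤ ENNReal.ofReal L ^ (2:ℝ) := by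
    intro q hq
    rw [ENNReal.ofReal_rpow_of_nonneg hL0 (by norm_num), ← ofReal_norm]
    apply ENNReal.ofReal_le_ofReal
    simpa using hb q hq
  constructor
  · intro z
    refine (enorm_integral_le_lintegral_enorm _).trans ?_
    calc _ ≤ ∫⁻ q in Dj S j, ENNReal.ofReal L ^ (2:ℝ) := by
          apply setLIntegral_mono_ae' hDm
          filter_upwards with q hq
          rw [enorm_mul, ← ofReal_norm (Complex.exp _), norm_expI, ENNReal.ofReal_one, one_mul]
          exact hbe q hq
      _ = _ := by simp
  · have h3 := h (volume.restrict (Dj S j)) sumMap sumMap_meas _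
      (sumMap_map c ((1/2:ℝ)^j) (by positivity) (Dj S j) hDm
        (fun q hq => ⟨hS2 hq.1, hS2 hq.2.1, hq.2.2.1⟩))
      (fun q => F q.1 * F q.2) (by fun_prop) (L^2)
      ((ae_restrict_iff' hDm).2 (Eventually.of_forall hb))
    refine h3.trans ?_
    have e : ENNReal.ofReal (2 / π * (1 / 2) ^ j)⁻¹ = ENNReal.ofReal (π/2) * (ENNReal.ofReal ((1/2:ℝ)^j))⁻¹ := by
      rw [mul_inv, ENNReal.ofReal_mul (by positivity), ← ENNReal.ofReal_inv_of_pos (by positivity : (0:ℝ) < (1/2)^j)]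
      congr 2
      rw [inv_div]
    rw [e, mul_assoc, mul_assoc]
    gcongr
    calc _ ≤ ∫⁻ q in Dj S j, (ENNReal.ofReal L ^ (2:ℝ)) ^ (2:ℝ) := by
          apply setLIntegral_mono_ae' hDm
          filter_upwards with q hq
          gcongr
          exact hbe q hq
      _ = _ := by simp

theorem T_sq_le (c : ℝ) (S : Set ℝ)
    (hS : MeasurableSet S) (hS2 : S ⊆ Ioc c (c + π/2)) 
    (F : ℝ → ℂ) (hF : Measurable F) (L : ℝ) (hL : ∀ x ∈ S, ‖F x‖ ≤ L) (z : ℝ × ℝ) :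
    ‖T F S z‖ₑ ^ (2:ℝ) ≤ 2 * ∑' j, ‖Bj F (Dj S j) z‖ₑ := by
  have hpi := Real.pi_pos
  have hfin : volume S < ∞ := (measure_mono hS2).trans_lt (by simp)
  have : IsFiniteMeasure (volume.restrict S) := ⟨by simpa using hfin⟩
  set g : ℝ × ℝ → ℂ := fun q => Complex.exp (Complex.I * ((z.1 * (sumMap q).1 + z.2 * (sumMap q).2 : ℝ) : ℂ)) *
    (F q.1 * F q.2) with hg
  set e : ℝ → ℂ := fun φ => Complex.exp (Complex.I * ((z.1 * cos φ + z.2 * sin φ : ℝ) : ℂ)) * F φ with he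
  have hem : Measurable e := by fun_prop
  have hge : ∀ q, g q = e q.1 * e q.2 := by
    intro q
    simp only [hg, he, sumMap]
    rw [mul_mul_mul_comm, ← Complex.exp_add]
    congr 2
    push_cast; ring
  have hei : IntegrableOn e S := by
    refine Integrable.of_bound hem.aestronglyMeasurable L ((ae_restrict_iff' hS).2 (Eventually.of_forall ?_))
    intro x hx
    simp only [he]
    rw [norm_mul, norm_expI, one_mul]; exact hL x hx
  have hgi : IntegrableOn g (S ×ˢ S) := by
    have : Integrable (fun q : ℝ × ℝ => e q.1 * e q.2) ((volume.restrict S).prod (volume.restrict S)) :=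
      hei.mul_prod hei
    rw [Measure.prod_restrict] at this
    refine this.congr (Eventually.of_forall fun q => (hge q).symm)
  have hT : T F S z ^ 2 = ∫ q in S ×ˢ S, g q := by
    have h1 : T F S z = ∫ φ in S, e φ := rfl
    rw [h1, sq, ← setIntegral_prod_mul]
    exact integral_congr_ae (Eventually.of_forall fun q => (hge q).symm)
  set U : Set (ℝ × ℝ) := {q | q.1 ∈ S ∧ q.2 ∈ S ∧ q.1 < q.2} with hU
  set U' : Set (ℝ × ℝ) := {q | q.1 ∈ S ∧ q.2 ∈ S ∧ q.2 < q.1} with hU'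
  have mS1 : MeasurableSet {q : ℝ × ℝ | q.1 ∈ S} := measurable_fst hS
  have mS2 : MeasurableSet {q : ℝ × ℝ | q.2 ∈ S} := measurable_snd hS
  have mU : MeasurableSet U := mS1.inter (mS2.inter (measurableSet_lt measurable_fst measurable_snd))
  have mU' : MeasurableSet U' := mS1.inter (mS2.inter (measurableSet_lt measurable_snd measurable_fst))
  have hdiag : volume {q : ℝ × ℝ | q.1 = q.2} = 0 := by
    rw [Measure.volume_eq_prod, Measure.measure_prod_null (measurableSet_eq_fun measurable_fst measurable_snd)]
    filter_upwards with x
    have : Prod.mk x ⁻¹' {q : ℝ × ℝ | q.1 = q.2} = {x} := by ext y; simp [eq_comm]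
    rw [this]; simp
  have hae : (S ×ˢ S : Set (ℝ × ℝ)) =ᵐ[volume] (U ∪ U' : Set (ℝ × ℝ)) := by
    have : ∀ᵐ q : ℝ × ℝ, ¬ (q.1 = q.2) := by
      rw [ae_iff]; simpa using hdiag
    filter_upwards [this] with q hq
    apply propext
    change q ∈ S ×ˢ S ↔ q ∈ U ∪ U'
    simp only [hU, hU', mem_prod, mem_union, mem_ofPred_eq]
    constructor
    · rintro ⟨h1, h2⟩
      rcases lt_or_gt_of_ne hq with h | h
      · exact Or.inl ⟨h1, h2, h⟩
      · exact Or.inr ⟨h1, h2, h⟩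
    · rintro (⟨h1, h2, _⟩ | ⟨h1, h2, _⟩) <;> exact ⟨h1, h2⟩
  have hUs : U ⊆ S ×ˢ S := fun q hq => ⟨hq.1, hq.2.1⟩
  have hUs' : U' ⊆ S ×ˢ S := fun q hq => ⟨hq.1, hq.2.1⟩
  have hswap : ∫ q in U', g q = ∫ q in U, g q := by
    have mp : MeasurePreserving (Prod.swap : ℝ × ℝ → ℝ × ℝ) volume volume := Measure.measurePreserving_swap
    have := mp.setIntegral_preimage_emb (MeasurableEquiv.prodComm.measurableEmbedding) g U
    rw [← this]
    have h1 : Prod.swap ⁻¹' U = U' := by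
      ext q; simp only [hU, hU', mem_preimage, mem_ofPred_eq, Prod.fst_swap, Prod.snd_swap]; tauto
    rw [h1]
    refine integral_congr_ae (Eventually.of_forall fun q => ?_)
    simp only [hge, Prod.fst_swap, Prod.snd_swap, mul_comm]
  have hT2 : T F S z ^ 2 = 2 * ∫ q in U, g q := by
    rw [hT, setIntegral_congr_set hae, setIntegral_union _ mU' (hgi.mono_set hUs) (hgi.mono_set hUs'), hswap, two_mul]
    rw [Set.disjoint_left]
    rintro q ⟨_, _, h⟩ ⟨_, _, h'⟩
    linarith
  have hUu : U = ⋃ j, Dj S j := by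
    ext q
    simp only [hU, mem_iUnion, Dj, mem_ofPred_eq]
    constructor
    · rintro ⟨h1, h2, h3⟩
      have a1 := hS2 h1
      have a2 := hS2 h2
      have h4 : (q.2 - q.1) / 2 ≤ 1 := by have := Real.pi_le_four; linarith [a1.1, a2.2]
      obtain ⟨n, hn1, hn2⟩ := exists_nat_pow_near_of_lt_one (x := (q.2 - q.1)/2) (y := (1/2:ℝ))
        (by linarith) h4 (by norm_num) (by norm_num)
      refine ⟨n, h1, h2, ?_, by linarith⟩
      rw [pow_succ] at hn1; linarith
    · rintro ⟨j, h1, h2, h3, _⟩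
      refine ⟨h1, h2, ?_⟩
      have : (0:ℝ) < (1/2)^j := by positivity
      linarith
  have hdis : Pairwise (Function.onFun Disjoint (Dj S)) := by
    have : ∀ i j, i < j → Disjoint (Dj S i) (Dj S j) := by
      intro i j hij
      rw [Set.disjoint_left]
      rintro q ⟨_, _, h, _⟩ ⟨_, _, _, h'⟩
      have : (1/2:ℝ)^j ≤ (1/2)^(i+1) := pow_le_pow_of_le_one (by norm_num) (by norm_num) hij
      rw [pow_succ] at this
      linarith
    intro i j hij
    rcases lt_or_gt_of_ne hij with h | h
    · exact this i j h
    · exact (this j i h).symm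
  have hsum : HasSum (fun j => Bj F (Dj S j) z) (∫ q in U, g q) := by
    rw [hUu]
    apply hasSum_integral_iUnion (fun j => Dj_meas S hS j) hdis
    rw [← hUu]; exact hgi.mono_set hUs
  have h5 : ‖∫ q in U, g q‖ₑ ≤ ∑' j, ‖Bj F (Dj S j) z‖ₑ := by
    rw [← hsum.tsum_eq]
    exact enorm_tsum_le_tsum_enorm
  calc ‖T F S z‖ₑ ^ (2:ℝ) = ‖T F S z ^ 2‖ₑ := by rw [enorm_pow]; norm_num
    _ = 2 * ‖∫ q in U, g q‖ₑ := by rw [hT2, enorm_mul]; congr 1; simp [← ofReal_norm]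
    _ ≤ _ := by gcongr


theorem numeric1 (p η : ℝ) (hp : 2 < p) (hη : 0 < η) (hη2 : η < 1 - 2/p) (K A d m D X : ℝ≥0∞)
    (hD : D ≠ 0) (hD' : D ≠ ∞) (hd : d ≤ m * min m (2 * D))
    (hX : X ≤ (A * d) ^ (p-2) * (K * (D⁻¹ * (A ^ (2:ℝ) * d)))) :
    X ^ (1/p) ≤ (K ^ (1/p) * 2 ^ (1/p + η)) * (A * m ^ (2 - 3/p - η)) * D ^ η := by
  have hp0 : 0 < p := by linarith
  have hpinv : 0 < 1/p := by positivity
  have hpp : p * (1/p) = 1 := by field_simp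
  have e1 : (A * d) ^ (p-2) * (K * (D⁻¹ * (A ^ (2:ℝ) * d))) = K * D⁻¹ * A ^ p * d ^ (p-1) := by
    rw [ENNReal.mul_rpow_of_nonneg _ _ (by linarith)]
    have h1 : A ^ p = A ^ (p-2) * A ^ (2:ℝ) := by
      rw [← ENNReal.rpow_add_of_nonneg _ _ (by linarith) (by norm_num)]; congr 1; ring
    have h2 : d ^ (p-1) = d ^ (p-2) * d := by
      nth_rewrite 3 [← ENNReal.rpow_one d]
      rw [← ENNReal.rpow_add_of_nonneg _ _ (by linarith) (by norm_num)]; congr 1; ring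
    rw [h1, h2]; ring
  rw [e1] at hX
  have e2 : X ^ (1/p) ≤ K ^ (1/p) * (D ^ (1/p))⁻¹ * A * d ^ (1 - 1/p) := by
    refine (ENNReal.rpow_le_rpow hX hpinv.le).trans (le_of_eq ?_)
    rw [ENNReal.mul_rpow_of_nonneg _ _ hpinv.le, ENNReal.mul_rpow_of_nonneg _ _ hpinv.le,
      ENNReal.mul_rpow_of_nonneg _ _ hpinv.le, ENNReal.inv_rpow, ← ENNReal.rpow_mul, hpp,
      ENNReal.rpow_one, ← ENNReal.rpow_mul]
    congr 2; field_simp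
  have h2p : 2/p = 2 * (1/p) := by ring
  have h3p : 3/p = 3 * (1/p) := by ring
  rw [h2p] at hη2
  rw [h3p]
  set u := 1/p with hu
  set t := min m (2 * D) with ht
  have e3 : d ^ (1 - u) ≤ m ^ (2 - 3 * u - η) * (2 ^ (u + η) * (D ^ u * D ^ η)) := by
    calc d ^ (1-u) ≤ (m * t) ^ (1-u) := ENNReal.rpow_le_rpow hd (by linarith)
      _ = m ^ (1-u) * (t ^ (1 - 2*u - η) * t ^ (u + η)) := by
        rw [ENNReal.mul_rpow_of_nonneg _ _ (by linarith), ← ENNReal.rpow_add_of_nonneg _ _ (by linarith) (by linarith)]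
        congr 2; ring
      _ ≤ m ^ (1-u) * (m ^ (1 - 2*u - η) * (2 * D) ^ (u + η)) := by
        gcongr
        · exact min_le_left _ _
        · exact min_le_right _ _
      _ = _ := by
        rw [ENNReal.mul_rpow_of_nonneg _ _ (by linarith), ENNReal.rpow_add_of_nonneg (x := D) _ _ hpinv.le hη.le,
          ← mul_assoc, ← ENNReal.rpow_add_of_nonneg _ _ (by linarith) (by linarith)]
        congr 2; ring
  have hDu : D ^ u ≠ 0 := by simp [ENNReal.rpow_eq_zero_iff, hD, hD']
  have hDu' : D ^ u ≠ ∞ := ENNReal.rpow_ne_top_of_nonneg hpinv.le hD'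
  calc X ^ u ≤ K ^ u * (D ^ u)⁻¹ * A * (m ^ (2 - 3 * u - η) * (2 ^ (u + η) * (D ^ u * D ^ η))) := by
        refine e2.trans ?_; gcongr
    _ = (K ^ u * 2 ^ (u + η)) * (A * m ^ (2 - 3*u - η)) * D ^ η * ((D^u)⁻¹ * D^u) := by ring
    _ = _ := by rw [ENNReal.inv_mul_cancel hDu hDu', mul_one]

theorem geom_fin (η : ℝ) (hη : 0 < η) : ∑' j : ℕ, (ENNReal.ofReal ((1/2:ℝ)^j)) ^ η ≠ ∞ := by
  have : ∀ j : ℕ, (ENNReal.ofReal ((1/2:ℝ)^j)) ^ η = ((ENNReal.ofReal (1/2)) ^ η) ^ j := by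
    intro j
    rw [ENNReal.ofReal_pow (by norm_num), ← ENNReal.rpow_natCast, ← ENNReal.rpow_natCast,
      ← ENNReal.rpow_mul, ← ENNReal.rpow_mul, mul_comm]
  simp_rw [this]
  rw [ENNReal.tsum_geometric]
  simp only [ne_eq, ENNReal.inv_eq_top, tsub_eq_zero_iff_le, not_le]
  apply ENNReal.rpow_lt_one _ hη
  rw [ENNReal.ofReal_lt_one]; norm_num

theorem T_Lp (p η : ℝ) (hp : 2 < p) (hη : 0 < η) (hη2 : η < 1 - 2/p) :
    ∃ K : ℝ≥0∞, K ≠ ∞ ∧ ∀ (c : ℝ) (S : Set ℝ)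
    (_ : MeasurableSet S) (_ : S ⊆ Ioc c (c + π/2)) 
    (F : ℝ → ℂ) (_ : Measurable F) (L : ℝ) (_ : 0 ≤ L) (_ : ∀ x ∈ S, ‖F x‖ ≤ L),
    (∫⁻ z, ‖T F S z‖ₑ ^ (2 * p)) ^ (1/p) ≤
      K * (ENNReal.ofReal L ^ (2:ℝ) * volume S ^ (2 - 3/p - η)) := by
  obtain ⟨K, hK, h⟩ := Bj_L2
  set G := ∑' j : ℕ, (ENNReal.ofReal ((1/2:ℝ)^j)) ^ η with hG
  have hp0 : 0 < p := by linarith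
  refine ⟨2 * (K ^ (1/p) * 2 ^ (1/p + η)) * G, ?_, ?_⟩
  · have h1 : K ^ (1/p) ≠ ∞ := ENNReal.rpow_ne_top_of_nonneg (by positivity) hK
    have h2 : (2:ℝ≥0∞) ^ (1/p+η) ≠ ∞ := ENNReal.rpow_ne_top_of_nonneg (by positivity) (by norm_num)
    exact ENNReal.mul_ne_top (ENNReal.mul_ne_top (by norm_num) (ENNReal.mul_ne_top h1 h2)) (geom_fin η hη)
  intro c S hS hS2 F hF L hL0 hL
  have key : ∀ j, (∫⁻ z, ‖Bj F (Dj S j) z‖ₑ ^ p) ^ (1/p) ≤ 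
      (K ^ (1/p) * 2 ^ (1/p + η)) * (ENNReal.ofReal L ^ (2:ℝ) * volume S ^ (2 - 3/p - η)) *
        (ENNReal.ofReal ((1/2:ℝ)^j)) ^ η := by
    intro j
    obtain ⟨h1, h2⟩ := h c S hS hS2 F hF L hL0 hL j
    refine numeric1 p η hp hη hη2 K _ (volume (Dj S j)) _ _ _ ?_ ENNReal.ofReal_ne_top (Dj_vol S hS j) ?_
    · have : (0:ℝ) < (1/2)^j := by positivity
      simpa using this
    · calc ∫⁻ z, ‖Bj F (Dj S j) z‖ₑ ^ p 
          ≤ ∫⁻ z, (ENNReal.ofReal L ^ (2:ℝ) * volume (Dj S j)) ^ (p-2) * ‖Bj F (Dj S j) z‖ₑ ^ (2:ℝ) := by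
            refine lintegral_mono fun z => ?_
            have : ‖Bj F (Dj S j) z‖ₑ ^ p = ‖Bj F (Dj S j) z‖ₑ ^ (p-2) * ‖Bj F (Dj S j) z‖ₑ ^ (2:ℝ) := by
              rw [← ENNReal.rpow_add_of_nonneg _ _ (by linarith) (by norm_num)]; congr 1; ring
            rw [this]
            gcongr
            exact h1 z
        _ = (ENNReal.ofReal L ^ (2:ℝ) * volume (Dj S j)) ^ (p-2) * ∫⁻ z, ‖Bj F (Dj S j) z‖ₑ ^ (2:ℝ) := by
            rw [lintegral_const_mul]
            exact (Bj_meas F hF _).enorm.pow_const _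
        _ ≤ _ := by gcongr
  calc (∫⁻ z, ‖T F S z‖ₑ ^ (2 * p)) ^ (1/p) 
      ≤ (∫⁻ z, (2 * ∑' j, ‖Bj F (Dj S j) z‖ₑ) ^ p) ^ (1/p) := by
        gcongr with z
        rw [ENNReal.rpow_mul]
        gcongr
        exact T_sq_le c S hS hS2 F hF L hL z
    _ = 2 * (∫⁻ z, (∑' j, ‖Bj F (Dj S j) z‖ₑ) ^ p) ^ (1/p) := by
        simp_rw [ENNReal.mul_rpow_of_nonneg _ _ hp0.le]
        rw [lintegral_const_mul' _ _ (ENNReal.rpow_ne_top_of_nonneg hp0.le (by norm_num)),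
          ENNReal.mul_rpow_of_nonneg _ _ (by positivity), ← ENNReal.rpow_mul]
        congr 1
        rw [mul_one_div_cancel hp0.ne', ENNReal.rpow_one]
    _ ≤ 2 * ∑' j, (∫⁻ z, ‖Bj F (Dj S j) z‖ₑ ^ p) ^ (1/p) := by
        gcongr
        exact mink _ p (by linarith) _ (fun j => (Bj_meas F hF _).enorm)
    _ ≤ 2 * ∑' j, (K ^ (1/p) * 2 ^ (1/p + η)) * (ENNReal.ofReal L ^ (2:ℝ) * volume S ^ (2 - 3/p - η)) *
        (ENNReal.ofReal ((1/2:ℝ)^j)) ^ η := by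
        gcongr with j
        exact key j
    _ = _ := by rw [ENNReal.tsum_mul_left]; ring


theorem w_int (ε : ℝ) (hε : 0 < ε) : ∫⁻ x : ℝ, ENNReal.ofReal ((1+|x|)^(-(1+ε))) ≠ ∞ := by
  have h := integrable_one_add_norm (E := ℝ) (μ := volume) (r := 1+ε) (by simp; exact hε)
  simp only [Real.norm_eq_abs] at h
  exact (h.lintegral_lt_top).ne

theorem core (q α ε s η ρ κ : ℝ) (hq : 0 < q) (hε : 0 < ε) (hκ : α = κ*(1+ε)) (hκ0 : 0 ≤ κ)
    (hθ : 0 < 1-2*κ) (hs0 : 0 < s) (hs : s < 1/4) (hqs : (1-2*κ)*s+κ = 1/q) (hη : 0 < η)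
    (hη2 : η < 1-4*s) (hρ0 : 0 ≤ ρ) (hρ : ρ < (1-2*κ)*(1-3*s-η/2)) :
    ∃ K : ℝ≥0∞, K ≠ ∞ ∧ ∀ (i : ℕ) (_ : i < 4) (k : ℕ) (S : Set ℝ)
    (_ : MeasurableSet S) (_ : S ⊆ Ioc (i * (π/2)) (i * (π/2) + π/2))
    (_ : ∀ x ∈ S, (1/2:ℝ)^(k+1) < |cos x|) (_ : ∀ x ∈ S, |cos x| ≤ (1/2:ℝ)^k)
    (F : ℝ → ℂ) (_ : Measurable F) (L : ℝ) (_ : 0 ≤ L) (_ : ∀ x ∈ S, ‖F x‖ ≤ L),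
    (∫⁻ z : ℝ × ℝ, (‖T F S z‖ₑ * ENNReal.ofReal ((1+|z.1|)^(-α))) ^ q) ^ (1/q) ≤
      K * (ENNReal.ofReal L * volume S ^ ρ *
        ENNReal.ofReal ((1/2:ℝ)^k) ^ ((1-2*κ)*(1-3*s-η/2) - ρ)) := by
  have hpi := Real.pi_pos
  obtain ⟨K1, hK1, h1⟩ := T_Lp (1/(2*s)) η (by rw [lt_div_iff₀ (by positivity)]; linarith) hη
    (by have : 2/(1/(2*s)) = 4*s := by field_simp; norm_num
        rw [this]; exact hη2)
  obtain ⟨K2, hK2, h2⟩ := T_line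
  set I := ∫⁻ x : ℝ, ENNReal.ofReal ((1+|x|)^(-(1+ε))) with hI
  have hIf : I ≠ ∞ := w_int ε hε
  set θ := 1-2*κ with hθd
  set τ := θ*(1-3*s-η/2) with hτ
  refine ⟨K1^(θ/2) * (I * (K2 * ENNReal.ofReal (2*π)))^κ * ENNReal.ofReal π ^ (τ-ρ), ?_, ?_⟩
  · refine ENNReal.mul_ne_top (ENNReal.mul_ne_top ?_ ?_) ?_
    · exact ENNReal.rpow_ne_top_of_nonneg (by positivity) hK1
    · exact ENNReal.rpow_ne_top_of_nonneg hκ0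
        (ENNReal.mul_ne_top hIf (ENNReal.mul_ne_top hK2 ENNReal.ofReal_ne_top))
    · exact ENNReal.rpow_ne_top_of_nonneg (by linarith) ENNReal.ofReal_ne_top
  intro i hi k S hS hS2 hS3 hS4 F hF L hL0 hL
  have hTm := T_meas F hF S
  have hm : volume S ≤ ENNReal.ofReal (π * (1/2:ℝ)^k) := cos_small i hi _ S hS2 hS4
  set m := volume S with hmd
  set A := ENNReal.ofReal L with hA
  set w : ℝ × ℝ → ℝ≥0∞ := fun z => ENNReal.ofReal ((1+|z.1|)^(-(1+ε))) with hw
  have hwm : Measurable w := by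
    rw [hw]; fun_prop
  have hf1 := h1 _ S hS hS2 F hF L hL0 hL
  rw [show (1:ℝ)/(1/(2*s)) = 2*s by field_simp, show (2:ℝ)*(1/(2*s)) = 1/s by field_simp,
    show (2:ℝ) - 3/(1/(2*s)) - η = 2*(1-3*s-η/2) by field_simp] at hf1
  have hg : ∫⁻ z, ‖T F S z‖ₑ^(2:ℝ) * w z ≤ (I * (K2 * ENNReal.ofReal (2*π))) * A^(2:ℝ) := by
    rw [Measure.volume_eq_prod, lintegral_prod _ (by fun_prop)]
    calc _ ≤ ∫⁻ x : ℝ, (K2 * (ENNReal.ofReal ((1/2:ℝ)^(k+1))⁻¹ * (A ^ (2:ℝ) * m))) * ENNReal.ofReal ((1+|x|)^(-(1+ε))) := by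
          refine lintegral_mono fun x => ?_
          simp only [hw]
          rw [lintegral_mul_const' _ _ ENNReal.ofReal_ne_top]
          gcongr
          exact h2 i hi _ (by positivity) S hS hS2 hS3 F hF L hL x
      _ = (K2 * (ENNReal.ofReal ((1/2:ℝ)^(k+1))⁻¹ * (A ^ (2:ℝ) * m))) * I := by
          rw [lintegral_const_mul _ (by fun_prop)]
      _ ≤ (K2 * (ENNReal.ofReal ((1/2:ℝ)^(k+1))⁻¹ * (A ^ (2:ℝ) * ENNReal.ofReal (π * (1/2:ℝ)^k)))) * I := by
          gcongr
      _ = (K2 * ((ENNReal.ofReal ((1/2:ℝ)^(k+1))⁻¹ * ENNReal.ofReal (π * (1/2:ℝ)^k)) * A ^ (2:ℝ))) * I := by ring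
      _ = _ := by
          rw [← ENNReal.ofReal_mul (by positivity)]
          have : ((1/2:ℝ)^(k+1))⁻¹ * (π * (1/2:ℝ)^k) = 2*π := by
            rw [pow_succ]; field_simp
          rw [this]; ring
  have hu0 : 0 ≤ θ*s*q := by positivity
  have hv0 : 0 ≤ κ*q := by positivity
  have huv : θ*s*q + κ*q = 1 := by
    rw [← add_mul, hqs]; field_simp
  have hH := ENNReal.lintegral_mul_norm_pow_le (μ := (volume : Measure (ℝ×ℝ)))
    (f := fun z => ‖T F S z‖ₑ^(1/s)) (g := fun z => ‖T F S z‖ₑ^(2:ℝ) * w z)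
    (by fun_prop) (by fun_prop) hu0 hv0 huv
  have hpt : ∀ z : ℝ × ℝ, (‖T F S z‖ₑ * ENNReal.ofReal ((1+|z.1|)^(-α))) ^ q =
      (‖T F S z‖ₑ^(1/s)) ^ (θ*s*q) * (‖T F S z‖ₑ^(2:ℝ) * w z) ^ (κ*q) := by
    intro z
    have hp : 0 < 1 + |z.1| := by positivity
    rw [ENNReal.mul_rpow_of_nonneg _ _ hq.le, ENNReal.mul_rpow_of_nonneg _ _ hv0,
      ← ENNReal.rpow_mul, ← ENNReal.rpow_mul, ← mul_assoc,
      ← ENNReal.rpow_add_of_nonneg _ _ (by positivity) (by positivity)]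
    congr 1
    · congr 1
      field_simp
      rw [hθd]; ring
    · simp only [hw]
      rw [ENNReal.ofReal_rpow_of_pos (by positivity), ENNReal.ofReal_rpow_of_pos (by positivity),
        ← Real.rpow_mul hp.le, ← Real.rpow_mul hp.le, hκ]
      congr 2; ring
  simp_rw [hpt]
  have hτρ : 0 ≤ τ - ρ := by linarith
  calc _ ≤ ((∫⁻ z, ‖T F S z‖ₑ^(1/s)) ^ (θ*s*q) * (∫⁻ z, ‖T F S z‖ₑ^(2:ℝ) * w z)^(κ*q)) ^ (1/q) := by
        gcongr
    _ = ((∫⁻ z, ‖T F S z‖ₑ^(1/s)) ^ (2*s)) ^ (θ/2) * (∫⁻ z, ‖T F S z‖ₑ^(2:ℝ) * w z)^κ := by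
        rw [ENNReal.mul_rpow_of_nonneg _ _ (by positivity), ← ENNReal.rpow_mul, ← ENNReal.rpow_mul,
          ← ENNReal.rpow_mul]
        congr 2 <;> field_simp
    _ ≤ (K1 * (A^(2:ℝ) * m^(2*(1-3*s-η/2)))) ^ (θ/2) * ((I * (K2 * ENNReal.ofReal (2*π))) * A^(2:ℝ))^κ := by
        gcongr
    _ = K1^(θ/2) * (I * (K2 * ENNReal.ofReal (2*π)))^κ * (A * m^τ) := by
        rw [ENNReal.mul_rpow_of_nonneg _ _ (by positivity), ENNReal.mul_rpow_of_nonneg _ _ (by positivity),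
          ENNReal.mul_rpow_of_nonneg _ _ hκ0, ← ENNReal.rpow_mul, ← ENNReal.rpow_mul, ← ENNReal.rpow_mul]
        have e1 : A = A^(2*(θ/2)) * A^(2*κ) := by
          rw [← ENNReal.rpow_add_of_nonneg _ _ (by positivity) (by positivity)]
          rw [show 2*(θ/2)+2*κ = 1 by rw [hθd]; ring, ENNReal.rpow_one]
        have e2 : 2*(1-3*s-η/2)*(θ/2) = τ := by rw [hτ]; ring
        rw [e2]
        nth_rewrite 3 [e1]
        ring
    _ ≤ K1^(θ/2) * (I * (K2 * ENNReal.ofReal (2*π)))^κ * (A * (m^ρ * (ENNReal.ofReal (π * (1/2:ℝ)^k)) ^(τ-ρ))) := by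
        have : m^τ = m^ρ * m^(τ-ρ) := by
          rw [← ENNReal.rpow_add_of_nonneg _ _ hρ0 hτρ]; congr 1; ring
        rw [this]
        gcongr
    _ = _ := by
        rw [ENNReal.ofReal_mul hpi.le, ENNReal.mul_rpow_of_nonneg _ _ hτρ]; ring


theorem params (q α r : ℝ) (hq : 0 < q) (hα0 : 0 ≤ α) (hα : α < 1/q) (h2 : 2/q - 1/2 < α)
    (h3 : 3/q - (1 - 1/r) < α) :
    ∃ ε s η ρ κ : ℝ, 0 < ε ∧ α = κ*(1+ε) ∧ 0 ≤ κ ∧ 0 < 1-2*κ ∧ 0 < s ∧ s < 1/4 ∧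
      (1-2*κ)*s+κ = 1/q ∧ 0 < η ∧ η < 1-4*s ∧ 1/r < ρ ∧ ρ < (1-2*κ)*(1-3*s-η/2) := by
  have e2 : 2/q = 2*(1/q) := by ring
  have e3 : 3/q = 3*(1/q) := by ring
  rw [e2] at h2
  rw [e3] at h3
  set b := 1/q with hb
  set R := 1/r with hR
  have hκ : ∃ ε κ : ℝ, 0 < ε ∧ α = κ*(1+ε) ∧ 0 ≤ κ ∧ κ ≤ α ∧ 2*b-1/2 < κ ∧ 3*b-(1-R) < κ := by
    rcases hα0.eq_or_lt with h | h
    · exact ⟨1, 0, by norm_num, by simp [← h], le_rfl, hα0, by linarith, by linarith⟩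
    · obtain ⟨κ, hκ1, hκ2⟩ := exists_between (show max 0 (max (2*b-1/2) (3*b-(1-R))) < α from
        max_lt h (max_lt h2 h3))
      have hk0 : 0 < κ := (le_max_left _ _).trans_lt hκ1
      refine ⟨α/κ - 1, κ, ?_, ?_, hk0.le, hκ2.le, ?_, ?_⟩
      · have : 1 < α/κ := by rw [lt_div_iff₀ hk0]; linarith
        linarith
      · field_simp; ring
      · exact ((le_max_left _ _).trans (le_max_right _ _)).trans_lt hκ1
      · exact ((le_max_right _ _).trans (le_max_right _ _)).trans_lt hκ1
  obtain ⟨ε, κ, hε, hακ, hκ0, hκα, hk2, hk3⟩ := hκ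
  have hθ : 0 < 1-2*κ := by linarith
  set θ := 1-2*κ with hθd
  have hs : (b-κ)/θ*θ = b-κ := by field_simp
  set s := (b-κ)/θ with hsd
  have hs0 : 0 < s := by apply div_pos <;> linarith
  have hs4 : s < 1/4 := by rw [hsd, div_lt_iff₀ hθ]; linarith
  have hτ : R < θ*(1-3*s) := by nlinarith
  set D := (θ*(1-3*s)-R)/θ with hD
  have hD0 : 0 < D := by apply div_pos <;> linarith
  have hDe : θ*D = θ*(1-3*s)-R := by rw [hD]; field_simp
  obtain ⟨η, hη0, hη1⟩ := exists_between (show 0 < min (1-4*s) D from lt_min (by linarith) hD0)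
  have hη2 := hη1.trans_le (min_le_left _ _)
  have hη3 := hη1.trans_le (min_le_right _ _)
  have : R < θ*(1-3*s-η/2) := by nlinarith
  obtain ⟨ρ, hρ1, hρ2⟩ := exists_between this
  exact ⟨ε, s, η, ρ, κ, hε, hακ, hκ0, hθ, hs0, hs4, by linarith, hη0, hη2, hρ1, hρ2⟩

def lev (F : ℝ → ℂ) : ℕ → Set ℝ
  | 0 => {x | ‖F x‖ ≤ 1}
  | (l+1) => {x | (2:ℝ)^l < ‖F x‖ ∧ ‖F x‖ ≤ (2:ℝ)^(l+1)}

theorem lev_le (F : ℝ → ℂ) (l : ℕ) (x : ℝ) (hx : x ∈ lev F l) : ‖F x‖ ≤ (2:ℝ)^l := by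
  cases l with
  | zero => simpa [lev] using hx
  | succ l => exact hx.2

theorem lev_meas (F : ℝ → ℂ) (hF : Measurable F) (l : ℕ) : MeasurableSet (lev F l) := by
  cases l with
  | zero => exact hF.norm measurableSet_Iic
  | succ l => exact hF.norm measurableSet_Ioc

theorem lev_lt (F : ℝ → ℂ) (l l' : ℕ) (h : l < l') (x : ℝ) (hx : x ∈ lev F l) (hx' : x ∈ lev F l') :
    False := by
  cases l' with
  | zero => omega
  | succ n =>
    have h1 := lev_le F l x hx
    have h2 := hx'.1
    have : (2:ℝ)^l ≤ 2^n := pow_le_pow_right₀ (by norm_num) (by omega)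
    linarith

theorem lev_unique (F : ℝ → ℂ) (l l' : ℕ) (x : ℝ) (hx : x ∈ lev F l) (hx' : x ∈ lev F l') :
    l = l' := by
  rcases lt_trichotomy l l' with h | h | h
  · exact (lev_lt F l l' h x hx hx').elim
  · exact h
  · exact (lev_lt F l' l h x hx' hx).elim

theorem lev_ex (F : ℝ → ℂ) (x : ℝ) : ∃ l, x ∈ lev F l := by
  obtain ⟨n, hn⟩ := pow_unbounded_of_one_lt ‖F x‖ (by norm_num : (1:ℝ) < 2)
  classical
  have hex : ∃ n, ‖F x‖ ≤ (2:ℝ)^n := ⟨n, hn.le⟩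
  refine ⟨Nat.find hex, ?_⟩
  have h1 := Nat.find_spec hex
  generalize hk : Nat.find hex = k at h1
  cases k with
  | zero => simpa [lev] using h1
  | succ k =>
    refine ⟨?_, h1⟩
    have := Nat.find_min hex (m := k) (by omega)
    exact not_le.1 this

def cosl (k : ℕ) : Set ℝ := {x | (1/2:ℝ)^(k+1) < |cos x| ∧ |cos x| ≤ (1/2:ℝ)^k}

theorem cosl_meas (k : ℕ) : MeasurableSet (cosl k) :=
  (continuous_abs.measurable.comp Real.measurable_cos) measurableSet_Ioc

theorem cosl_lt (k k' : ℕ) (h : k < k') (x : ℝ) (hx : x ∈ cosl k) (hx' : x ∈ cosl k') : False := by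
  have h1 := hx.1
  have h2 := hx'.2
  have : (1/2:ℝ)^k' ≤ (1/2)^(k+1) := pow_le_pow_of_le_one (by norm_num) (by norm_num) (by omega)
  linarith

theorem cosl_unique (l l' : ℕ) (x : ℝ) (hx : x ∈ cosl l) (hx' : x ∈ cosl l') :
    l = l' := by
  rcases lt_trichotomy l l' with h | h | h
  · exact (cosl_lt l l' h x hx hx').elim
  · exact h
  · exact (cosl_lt l' l h x hx' hx).elim

theorem cosl_ex (x : ℝ) (hx : cos x ≠ 0) : ∃ k, x ∈ cosl k := by
  have hpos : 0 < |cos x| := abs_pos.2 hx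
  obtain ⟨n, h1, h2⟩ := exists_nat_pow_near_of_lt_one hpos (abs_cos_le_one x) (by norm_num : (0:ℝ) < 1/2) (by norm_num)
  exact ⟨n, h1, h2⟩

def arc (i : ℕ) : Set ℝ := Ioc (i * (π/2)) (i * (π/2) + π/2)

theorem arc_lt (k k' : ℕ) (h : k < k') (x : ℝ) (hx : x ∈ arc k) (hx' : x ∈ arc k') : False := by
  have h1 := hx.2
  have h2 := hx'.1
  have h3 : (k:ℝ) + 1 ≤ k' := by exact_mod_cast h
  have := Real.pi_pos
  nlinarith

theorem arc_unique (l l' : ℕ) (x : ℝ) (hx : x ∈ arc l) (hx' : x ∈ arc l') :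
    l = l' := by
  rcases lt_trichotomy l l' with h | h | h
  · exact (arc_lt l l' h x hx hx').elim
  · exact h
  · exact (arc_lt l' l h x hx' hx).elim

theorem arc_ex (x : ℝ) (hx : x ∈ Ioc 0 (2*π)) : ∃ i : Fin 4, x ∈ arc i := by
  obtain ⟨h1, h2⟩ := hx
  by_cases a1 : x ≤ π/2
  · exact ⟨0, by simp [arc]; constructor <;> linarith⟩
  by_cases a2 : x ≤ π
  · refine ⟨1, ?_⟩
    simp [arc]; constructor <;> linarith
  by_cases a3 : x ≤ 3*π/2
  · refine ⟨2, ?_⟩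
    simp [arc]; constructor <;> linarith
  · refine ⟨3, ?_⟩
    simp [arc]; constructor <;> linarith

theorem arc_sub (i : Fin 4) : arc i ⊆ Ioc 0 (2*π) := by
  intro x hx
  obtain ⟨h1, h2⟩ := hx
  have h3 : ((i:ℕ):ℝ) ≤ 3 := by exact_mod_cast (by omega : (i:ℕ) ≤ 3)
  have h4 : (0:ℝ) ≤ ((i:ℕ):ℝ) := by positivity
  have := Real.pi_pos
  constructor <;> nlinarith

def piece (F : ℝ → ℂ) (j : Fin 4 × ℕ × ℕ) : Set ℝ := arc j.1 ∩ cosl j.2.1 ∩ lev F j.2.2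

theorem piece_meas (F : ℝ → ℂ) (hF : Measurable F) (j) : MeasurableSet (piece F j) :=
  (measurableSet_Ioc.inter (cosl_meas _)).inter (lev_meas F hF _)

theorem piece_disj (F : ℝ → ℂ) : Pairwise (Function.onFun Disjoint (piece F)) := by
  intro a b hab
  rw [Function.onFun, Set.disjoint_left]
  rintro x ⟨⟨h1, h2⟩, h3⟩ ⟨⟨g1, g2⟩, g3⟩
  apply hab
  exact Prod.ext (Fin.ext (arc_unique _ _ x h1 g1)) (Prod.ext (cosl_unique _ _ x h2 g2) (lev_unique F _ _ x h3 g3))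

theorem piece_union (F : ℝ → ℂ) : (⋃ j, piece F j) =ᵐ[volume] Ioc 0 (2*π) := by
  have hsub : (⋃ j, piece F j) ⊆ Ioc 0 (2*π) :=
    iUnion_subset fun j x hx => arc_sub _ hx.1.1
  have hnull : volume (Ioc 0 (2*π) \ ⋃ j, piece F j) = 0 := by
    refine measure_mono_null (t := ⋃ i : Fin 4, arc i ∩ {x | cos x = 0}) ?_ ?_
    · intro x hx
      obtain ⟨i, hi⟩ := arc_ex x hx.1
      obtain ⟨l, hl⟩ := lev_ex F x
      refine mem_iUnion.2 ⟨i, hi, ?_⟩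
      by_contra hc
      obtain ⟨k, hk⟩ := cosl_ex x hc
      exact hx.2 (mem_iUnion.2 ⟨(i,k,l), ⟨hi, hk⟩, hl⟩)
    · rw [measure_iUnion_null_iff]
      intro i
      have := cos_small i i.2 0 (arc i ∩ {x | cos x = 0}) inter_subset_left
        (fun x hx => by simp [hx.2.out])
      simpa using this
  exact (ae_eq_set.2 ⟨by rw [sdiff_eq_empty.2 hsub]; simp, hnull⟩)

theorem T_decomp (F : ℝ → ℂ) (hF : Measurable F) (hi : IntegrableOn F (Ioc 0 (2*π))) (z : ℝ × ℝ) :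
    ‖T F (Ioc 0 (2*π)) z‖ₑ ≤ ∑' j, ‖T F (piece F j) z‖ₑ := by
  have e : T F (Ioc 0 (2*π)) z = T F (⋃ j, piece F j) z := 
    setIntegral_congr_set (piece_union F).symm
  have hint : IntegrableOn (fun φ => Complex.exp (Complex.I * ((z.1 * cos φ + z.2 * sin φ : ℝ) : ℂ)) * F φ) (⋃ j, piece F j) := by
    have hsub : (⋃ j, piece F j) ⊆ Ioc 0 (2*π) :=
      iUnion_subset fun j x hx => arc_sub _ hx.1.1
    refine (hi.mono_set hsub).bdd_mul (c := 1) ?_ ?_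
    · apply Measurable.aestronglyMeasurable; fun_prop
    · exact Eventually.of_forall fun φ => (norm_expI _).le
  have := hasSum_integral_iUnion (piece_meas F hF) (piece_disj F) hint
  rw [e]
  unfold T
  rw [← this.tsum_eq]
  exact enorm_tsum_le_tsum_enorm


theorem piece_vol (F : ℝ → ℂ) (hF : Measurable F) (r : ℝ) (hr : 1 ≤ r)
    (h : ∫⁻ φ in Ioc 0 (2*π), ‖F φ‖ₑ^r ≤ 1) (j : Fin 4 × ℕ × ℕ) :
    volume (piece F j) ≤ ENNReal.ofReal (2*π*2^r) * (ENNReal.ofReal ((1/2:ℝ)^j.2.2)) ^ r := by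
  have hpi := Real.pi_gt_three
  have hr0 : 0 < r := by linarith
  have h2r : (1:ℝ) ≤ 2^r := Real.one_le_rpow (by norm_num) hr0.le
  obtain ⟨i, k, l⟩ := j
  have hsub : piece F (i,k,l) ⊆ Ioc 0 (2*π) := fun x hx => arc_sub _ hx.1.1
  cases l with
  | zero =>
    simp only [pow_zero, ENNReal.ofReal_one, ENNReal.one_rpow, mul_one]
    calc _ ≤ volume (Ioc 0 (2*π)) := measure_mono hsub
      _ = ENNReal.ofReal (2*π) := by simp
      _ ≤ _ := by
        apply ENNReal.ofReal_le_ofReal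
        nlinarith
  | succ l =>
    simp only
    have h1 : (ENNReal.ofReal ((2:ℝ)^l))^r * volume (piece F (i,k,l+1)) ≤ 1 := by
      calc _ = ∫⁻ φ in piece F (i,k,l+1), (ENNReal.ofReal ((2:ℝ)^l))^r := by
              rw [setLIntegral_const]
        _ ≤ ∫⁻ φ in piece F (i,k,l+1), ‖F φ‖ₑ^r := by
              refine setLIntegral_mono' (piece_meas F hF _) fun x hx => ?_
              gcongr
              rw [← ofReal_norm]
              exact ENNReal.ofReal_le_ofReal hx.2.1.le
        _ ≤ ∫⁻ φ in Ioc 0 (2*π), ‖F φ‖ₑ^r := lintegral_mono_set hsub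
        _ ≤ 1 := h
    have h2 : (ENNReal.ofReal ((2:ℝ)^l))^r * (ENNReal.ofReal ((1/2:ℝ)^l))^r = 1 := by
      rw [← ENNReal.mul_rpow_of_nonneg _ _ hr0.le, ← ENNReal.ofReal_mul (by positivity), ← mul_pow]
      norm_num
    have h3 : ENNReal.ofReal (2^r) * (ENNReal.ofReal ((1/2:ℝ)^(l+1)))^r = (ENNReal.ofReal ((1/2:ℝ)^l))^r := by
      rw [← ENNReal.ofReal_rpow_of_pos (by norm_num), ← ENNReal.mul_rpow_of_nonneg _ _ hr0.le, ← ENNReal.ofReal_mul (by positivity)]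
      congr 2
      rw [pow_succ]; ring
    calc volume (piece F (i,k,l+1)) = ((ENNReal.ofReal ((2:ℝ)^l))^r * volume (piece F (i,k,l+1))) * (ENNReal.ofReal ((1/2:ℝ)^l))^r := by
          rw [mul_right_comm, h2, one_mul]
      _ ≤ 1 * (ENNReal.ofReal ((1/2:ℝ)^l))^r := by gcongr
      _ = 1 * (ENNReal.ofReal (2^r) * (ENNReal.ofReal ((1/2:ℝ)^(l+1)))^r) := by rw [h3]
      _ ≤ ENNReal.ofReal (2*π) * (ENNReal.ofReal (2^r) * (ENNReal.ofReal ((1/2:ℝ)^(l+1)))^r) := by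
          gcongr
          rw [ENNReal.one_le_ofReal]; linarith
      _ = _ := by rw [← mul_assoc, ← ENNReal.ofReal_mul (by positivity)]

theorem intOn_of_Lr (F : ℝ → ℂ) (hF : Measurable F) (r : ℝ) (hr : 1 ≤ r)
    (h : ∫⁻ φ in Ioc 0 (2*π), ‖F φ‖ₑ^r < ∞) : IntegrableOn F (Ioc 0 (2*π)) := by
  have hr0 : 0 < r := by linarith
  have : MemLp F (ENNReal.ofReal r) (volume.restrict (Ioc 0 (2*π))) := by
    refine ⟨hF.aestronglyMeasurable, ?_⟩
    rw [eLpNorm_lt_top_iff_lintegral_rpow_enorm_lt_top (by simpa using hr0) ENNReal.ofReal_ne_top,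
      ENNReal.toReal_ofReal hr0.le]
    exact h
  exact this.integrable (by rw [← ENNReal.ofReal_one]; exact ENNReal.ofReal_le_ofReal hr)

theorem L1norm (q α r : ℝ) (hq : 0 < q) (hα0 : 0 ≤ α) (hα : α < 1/q) (h2 : 2/q - 1/2 < α)
    (hr : 1 ≤ r) (h3 : 3/q - (1 - 1/r) < α) :
    ∃ K : ℝ≥0∞, K ≠ ∞ ∧ ∀ F : ℝ → ℂ, Measurable F → ∫⁻ φ in Ioc 0 (2*π), ‖F φ‖ₑ^r ≤ 1 →
    (∫⁻ z : ℝ × ℝ, (‖T F (Ioc 0 (2*π)) z‖ₑ * ENNReal.ofReal ((1+|z.1|)^(-α))) ^ q) ^ (1/q) ≤ K := by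
  obtain ⟨ε, s, η, ρ, κ, hε, hακ, hκ0, hθ, hs0, hs4, hqs, hη0, hη2, hρ1, hρ2⟩ :=
    params q α r hq hα0 hα h2 h3
  have hr0 : 0 < r := by linarith
  have hρ0 : 0 ≤ ρ := by
    have : 0 < 1/r := by positivity
    linarith
  obtain ⟨K, hK, hcore⟩ := core q α ε s η ρ κ hq hε hακ hκ0 hθ hs0 hs4 hqs hη0 hη2 hρ0 hρ2
  set σ := (1-2*κ)*(1-3*s-η/2) - ρ with hσ
  have hσ0 : 0 < σ := by linarith
  have hrρ : 0 < r*ρ - 1 := by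
    rw [div_lt_iff₀ hr0] at hρ1; linarith
  have hq1 : 1 ≤ q := by
    have e2 : 2/q = 2*(1/q) := by ring
    have : 1/q < 1 := by linarith
    rw [div_lt_one hq] at this
    exact this.le
  set G1 := ∑' j : ℕ, (ENNReal.ofReal ((1/2:ℝ)^j)) ^ (r*ρ-1)
  set G2 := ∑' j : ℕ, (ENNReal.ofReal ((1/2:ℝ)^j)) ^ σ
  have hG1 : G1 ≠ ∞ := geom_fin _ hrρ
  have hG2 : G2 ≠ ∞ := geom_fin _ hσ0
  set c := ENNReal.ofReal (2*π*2^r) ^ ρ with hc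
  have hcf : c ≠ ∞ := ENNReal.rpow_ne_top_of_nonneg hρ0 ENNReal.ofReal_ne_top
  refine ⟨4 * (G2 * (G1 * (K * c))), ?_, fun F hF hN => ?_⟩
  · exact ENNReal.mul_ne_top (by norm_num) (ENNReal.mul_ne_top hG2 (ENNReal.mul_ne_top hG1 (ENNReal.mul_ne_top hK hcf)))
  have hint := intOn_of_Lr F hF r hr (hN.trans_lt (by simp))
  have hpiece : ∀ j : Fin 4 × ℕ × ℕ, (∫⁻ z : ℝ × ℝ, (‖T F (piece F j) z‖ₑ * ENNReal.ofReal ((1+|z.1|)^(-α))) ^ q) ^ (1/q) ≤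
      (ENNReal.ofReal ((1/2:ℝ)^j.2.1)) ^ σ * ((ENNReal.ofReal ((1/2:ℝ)^j.2.2)) ^ (r*ρ-1) * (K * c)) := by
    intro j
    refine (hcore j.1 j.1.2 j.2.1 (piece F j) (piece_meas F hF j) (fun x hx => hx.1.1)
      (fun x hx => hx.1.2.1) (fun x hx => hx.1.2.2) F hF ((2:ℝ)^j.2.2) (by positivity)
      (fun x hx => lev_le F _ x hx.2)).trans ?_
    have hv := piece_vol F hF r hr hN j
    set y := ENNReal.ofReal ((1/2:ℝ)^j.2.2) with hy
    have hy1 : ENNReal.ofReal ((2:ℝ)^j.2.2) * y = 1 := by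
      rw [hy, ← ENNReal.ofReal_mul (by positivity), ← mul_pow]; norm_num
    have hyρ : y ^ (r*ρ) = y * y^(r*ρ-1) := by
      nth_rewrite 2 [← ENNReal.rpow_one y]
      rw [← ENNReal.rpow_add_of_nonneg _ _ (by norm_num) hrρ.le]; congr 1; ring
    calc _ ≤ K * (ENNReal.ofReal ((2:ℝ)^j.2.2) * (ENNReal.ofReal (2*π*2^r) * y ^ r)^ρ * (ENNReal.ofReal ((1/2:ℝ)^j.2.1)) ^ σ) := by
          gcongr
      _ = K * (ENNReal.ofReal ((2:ℝ)^j.2.2) * (c * (y * y^(r*ρ-1))) * (ENNReal.ofReal ((1/2:ℝ)^j.2.1)) ^ σ) := by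
          rw [ENNReal.mul_rpow_of_nonneg _ _ hρ0, ← ENNReal.rpow_mul, hyρ]
      _ = (ENNReal.ofReal ((2:ℝ)^j.2.2) * y) * ((ENNReal.ofReal ((1/2:ℝ)^j.2.1)) ^ σ * (y ^ (r*ρ-1) * (K * c))) := by ring
      _ = _ := by rw [hy1, one_mul]
  calc _ ≤ (∫⁻ z : ℝ × ℝ, (∑' j, ‖T F (piece F j) z‖ₑ * ENNReal.ofReal ((1+|z.1|)^(-α))) ^ q) ^ (1/q) := by
        gcongr with z
        rw [ENNReal.tsum_mul_right]
        gcongr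
        exact T_decomp F hF hint z
    _ ≤ ∑' j, (∫⁻ z : ℝ × ℝ, (‖T F (piece F j) z‖ₑ * ENNReal.ofReal ((1+|z.1|)^(-α))) ^ q) ^ (1/q) := by
        refine mink _ q hq1 _ fun j => ?_
        have := T_meas F hF (piece F j)
        fun_prop
    _ ≤ ∑' j : Fin 4 × ℕ × ℕ, (ENNReal.ofReal ((1/2:ℝ)^j.2.1)) ^ σ * ((ENNReal.ofReal ((1/2:ℝ)^j.2.2)) ^ (r*ρ-1) * (K * c)) :=
        ENNReal.tsum_le_tsum hpiece
    _ = _ := by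
        rw [ENNReal.tsum_prod']
        simp_rw [ENNReal.tsum_prod', ENNReal.tsum_mul_left, ENNReal.tsum_mul_right]
        simp [G1, G2, mul_assoc]

theorem T_smul (c : ℂ) (F : ℝ → ℂ) (S : Set ℝ) (z : ℝ × ℝ) : T (fun x => c * F x) S z = c * T F S z := by
  unfold T
  rw [← integral_const_mul]
  congr 1; ext φ; ring

theorem L1 (q α r : ℝ) (hq : 0 < q) (hα0 : 0 ≤ α) (hα : α < 1/q) (h2 : 2/q - 1/2 < α)
    (hr : 1 ≤ r) (h3 : 3/q - (1 - 1/r) < α) :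
    ∃ K : ℝ≥0∞, K ≠ ∞ ∧ ∀ F : ℝ → ℂ, Measurable F →
    (∫⁻ z : ℝ × ℝ, (‖T F (Ioc 0 (2*π)) z‖ₑ * ENNReal.ofReal ((1+|z.1|)^(-α))) ^ q) ^ (1/q) ≤
      K * (∫⁻ φ in Ioc 0 (2*π), ‖F φ‖ₑ^r) ^ (1/r) := by
  obtain ⟨K, hK, h⟩ := L1norm q α r hq hα0 hα h2 hr h3
  have hr0 : 0 < r := by linarith
  refine ⟨K + 1, by simpa using hK, fun F hF => ?_⟩
  set J := ∫⁻ φ in Ioc 0 (2*π), ‖F φ‖ₑ^r with hJ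
  set N := J ^ (1/r) with hN
  have hJN : J = N ^ r := by
    rw [hN, ← ENNReal.rpow_mul, one_div_mul_cancel hr0.ne', ENNReal.rpow_one]
  by_cases hNt : N = ∞
  · rw [hNt, ENNReal.mul_top (by simp)]; exact le_top
  by_cases hN0 : N = 0
  · have hJ0 : J = 0 := by rw [hJN, hN0, ENNReal.zero_rpow_of_pos hr0]
    rw [hJ, lintegral_eq_zero_iff (by fun_prop)] at hJ0
    have hT : ∀ z, T F (Ioc 0 (2*π)) z = 0 := by
      intro z
      unfold T
      refine integral_eq_zero_of_ae ?_
      filter_upwards [hJ0] with x hx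
      have : F x = 0 := by
        simpa [ENNReal.rpow_eq_zero_iff, hr0, hr0.le, not_lt.2 hr0.le] using hx
      simp [this]
    simp [hT, hq]
  have hNpos : 0 < N.toReal := ENNReal.toReal_pos hN0 hNt
  have hce : ‖((N.toReal : ℂ))⁻¹‖ₑ = N⁻¹ := by
    rw [enorm_inv (by exact_mod_cast hNpos.ne')]
    congr 1
    rw [← ofReal_norm, Complex.norm_real, Real.norm_of_nonneg hNpos.le, ENNReal.ofReal_toReal hNt]
  have h1 := h (fun x => ((N.toReal : ℂ))⁻¹ * F x) (by fun_prop) (by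
    simp_rw [enorm_mul, ENNReal.mul_rpow_of_nonneg _ _ hr0.le]
    rw [lintegral_const_mul _ (by fun_prop), ← hJ, hJN, hce, ← ENNReal.mul_rpow_of_nonneg _ _ hr0.le,
      ENNReal.inv_mul_cancel hN0 hNt, ENNReal.one_rpow])
  simp_rw [T_smul, enorm_mul, mul_assoc, ENNReal.mul_rpow_of_nonneg _ _ hq.le] at h1
  rw [lintegral_const_mul' _ _ (by rw [hce]; exact ENNReal.rpow_ne_top_of_nonneg hq.le (by simpa using hN0)),
    ENNReal.mul_rpow_of_nonneg _ _ (by positivity), ← ENNReal.rpow_mul, mul_one_div_cancel hq.ne', ENNReal.rpow_one, hce] at h1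
  simp_rw [ENNReal.mul_rpow_of_nonneg _ _ hq.le]
  set X := (∫⁻ z : ℝ × ℝ, ‖T F (Ioc 0 (2*π)) z‖ₑ ^ q * ENNReal.ofReal ((1+|z.1|)^(-α)) ^ q) ^ (1/q)
  calc X = N * (N⁻¹ * X) := by rw [← mul_assoc, ENNReal.mul_inv_cancel hN0 hNt, one_mul]
    _ ≤ N * K := by gcongr
    _ ≤ (K+1) * N := by rw [mul_comm]; gcongr; exact le_self_add


def W (α β : ℝ) (z : ℝ × ℝ) : ℝ≥0∞ := ENNReal.ofReal ((1+|z.1|)^(-α) * (1+|z.2|)^(-β))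

theorem W_meas (α β : ℝ) : Measurable (W α β) := by
  unfold W; fun_prop

def P (α β q r : ℝ) : Prop :=
    ∃ K : ℝ≥0∞, K ≠ ∞ ∧ ∀ F : ℝ → ℂ, Measurable F →
    (∫⁻ z : ℝ × ℝ, (‖T F (Ioc 0 (2*π)) z‖ₑ * W α β z) ^ q) ^ (1/q) ≤
      K * (∫⁻ φ in Ioc 0 (2*π), ‖F φ‖ₑ^r) ^ (1/r)

theorem P_mono (α β α1 β1 q r : ℝ) (hq : 0 < q) (ha : α ≤ α1) (hb : β ≤ β1) (h : P α β q r) : P α1 β1 q r := by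
  obtain ⟨K, hK, h⟩ := h
  refine ⟨K, hK, fun F hF => le_trans ?_ (h F hF)⟩
  gcongr with z
  unfold W
  apply ENNReal.ofReal_le_ofReal
  have h1 : 1 ≤ 1+|z.1| := by linarith [abs_nonneg z.1]
  have h2 : 1 ≤ 1+|z.2| := by linarith [abs_nonneg z.2]
  gcongr

theorem W_int (α β : ℝ) (ha : 1 < α) (hb : 1 < β) : ∫⁻ z, W α β z ≠ ∞ := by
  unfold W
  have hh : ∀ z : ℝ × ℝ, ENNReal.ofReal ((1+|z.1|)^(-α) * (1+|z.2|)^(-β)) = 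
      ENNReal.ofReal ((1+|z.1|)^(-α)) * ENNReal.ofReal ((1+|z.2|)^(-β)) := fun z =>
    ENNReal.ofReal_mul (by positivity)
  simp_rw [hh]
  rw [Measure.volume_eq_prod, lintegral_prod_mul (f := fun x : ℝ => ENNReal.ofReal ((1+|x|)^(-α)))
    (g := fun x : ℝ => ENNReal.ofReal ((1+|x|)^(-β))) (by fun_prop) (by fun_prop)]
  have h1 := w_int (α-1) (by linarith)
  have h2 := w_int (β-1) (by linarith)
  rw [show 1+(α-1) = α by ring] at h1
  rw [show 1+(β-1) = β by ring] at h2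
  exact ENNReal.mul_ne_top h1 h2

theorem W_rpow (α β t : ℝ) (z : ℝ × ℝ) : W α β z ^ t = W (α*t) (β*t) z := by
  unfold W
  have h1 : 0 < 1+|z.1| := by linarith [abs_nonneg z.1]
  have h2 : 0 < 1+|z.2| := by linarith [abs_nonneg z.2]
  rw [ENNReal.ofReal_rpow_of_pos (by positivity), Real.mul_rpow (by positivity) (by positivity),
    ← Real.rpow_mul h1.le, ← Real.rpow_mul h2.le]
  congr 3 <;> ring

theorem W_mul (α β α1 β1 : ℝ) (z : ℝ × ℝ) : W α β z * W α1 β1 z = W (α+α1) (β+β1) z := by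
  unfold W
  have h1 : 0 < 1+|z.1| := by linarith [abs_nonneg z.1]
  have h2 : 0 < 1+|z.2| := by linarith [abs_nonneg z.2]
  rw [← ENNReal.ofReal_mul (by positivity), neg_add, neg_add, Real.rpow_add h1, Real.rpow_add h2]
  congr 1; ring

theorem P_triv (α β q : ℝ) (hq : 0 < q) (ha : 1/q < α) (hb : 1/q < β) : P α β q 1 := by
  rw [div_lt_iff₀ hq] at ha hb
  refine ⟨(∫⁻ z, W (α*q) (β*q) z)^(1/q), ENNReal.rpow_ne_top_of_nonneg (by positivity) (W_int _ _ ha hb), fun F hF => ?_⟩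
  simp only [ENNReal.rpow_one, div_one]
  set N := ∫⁻ φ in Ioc 0 (2*π), ‖F φ‖ₑ with hN
  have hT : ∀ z, ‖T F (Ioc 0 (2*π)) z‖ₑ ≤ N := by
    intro z
    unfold T
    refine (enorm_integral_le_lintegral_enorm _).trans (le_of_eq ?_)
    refine lintegral_congr fun φ => ?_
    rw [enorm_mul, ← ofReal_norm, norm_expI]; simp
  calc _ ≤ (∫⁻ z, N^q * W (α*q) (β*q) z)^(1/q) := by
        gcongr with z
        rw [ENNReal.mul_rpow_of_nonneg _ _ hq.le, W_rpow]
        gcongr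
        exact hT z
    _ = _ := by
        rw [lintegral_const_mul _ (W_meas _ _), ENNReal.mul_rpow_of_nonneg _ _ (by positivity),
          ← ENNReal.rpow_mul, mul_one_div_cancel hq.ne', ENNReal.rpow_one, mul_comm]

theorem P_ii_le (α β q r : ℝ) (hq : 0 < q) (hβ : 0 ≤ β) (hβα : β ≤ α) (hα : α < 1/q) (hr : 1 ≤ r)
    (h2 : 2/q - 1/2 < α + β) (h3 : 3/q - (1-1/r) < α + 2*β) : P α β q r := by
  rcases hβ.eq_or_lt with h0 | h0
  · subst h0
    obtain ⟨K, hK, h⟩ := L1 q α r hq hβα hα (by linarith) hr (by linarith)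
    refine ⟨K, hK, fun F hF => ?_⟩
    have := h F hF
    simpa [W] using this
  have e2 : 2/q = 2*(1/q) := by ring
  have e3 : 3/q = 3*(1/q) := by ring
  rw [e2] at h2
  rw [e3] at h3
  obtain ⟨δ, hδ0, hδ⟩ := exists_between (show 0 < min β (min ((α+β - (2*(1/q)-1/2))/2) ((α+2*β-(3*(1/q)-(1-1/r)))/3)) from
    lt_min h0 (lt_min (by linarith) (by linarith)))
  rw [lt_min_iff, lt_min_iff] at hδ
  obtain ⟨hd1, hd2, hd3⟩ := hδ
  have hb' : 0 < 1/q - β + δ := by linarith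
  set q' := 1/(1/q-β+δ) with hq'
  have hq'0 : 0 < q' := by positivity
  have hq'i : 1/q' = 1/q-β+δ := by rw [hq']; field_simp
  have e2 : 2/q' = 2*(1/q') := by ring
  have e3 : 3/q' = 3*(1/q') := by ring
  obtain ⟨K, hK, h⟩ := L1 q' (α-β) r hq'0 (by linarith) (by rw [hq'i]; linarith) (by rw [e2, hq'i]; linarith) hr
    (by rw [e3, hq'i]; linarith)
  have hbd : 0 < β - δ := by linarith
  have h1lt : 1 < β * (1/(β-δ)) := by
    rw [mul_one_div, lt_div_iff₀ hbd]; linarith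
  set I := ∫⁻ z, W (β*(1/(β-δ))) (β*(1/(β-δ))) z with hI
  have hIf : I ≠ ∞ := W_int _ _ h1lt h1lt
  refine ⟨K * I^(β-δ), ENNReal.mul_ne_top hK (ENNReal.rpow_ne_top_of_nonneg hbd.le hIf), fun F hF => ?_⟩
  have hTm := T_meas F hF (Ioc 0 (2*π))
  have hWm := W_meas
  have hu : q * (1/q') + q*(β-δ) = 1 := by rw [hq'i]; field_simp; ring
  have hH := ENNReal.lintegral_mul_norm_pow_le (μ := (volume : Measure (ℝ×ℝ)))
    (f := fun z => (‖T F (Ioc 0 (2*π)) z‖ₑ * ENNReal.ofReal ((1+|z.1|)^(-(α-β))))^q')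
    (g := fun z => W (β*(1/(β-δ))) (β*(1/(β-δ))) z)
    (by fun_prop) (by fun_prop) (by positivity) (by positivity) hu
  have hpt : ∀ z : ℝ × ℝ, (‖T F (Ioc 0 (2*π)) z‖ₑ * W α β z)^q = 
     ((‖T F (Ioc 0 (2*π)) z‖ₑ * ENNReal.ofReal ((1+|z.1|)^(-(α-β))))^q')^(q*(1/q')) * 
      (W (β*(1/(β-δ))) (β*(1/(β-δ))) z)^(q*(β-δ)) := by
    intro z
    rw [← ENNReal.rpow_mul, show q' * (q*(1/q')) = q by field_simp, W_rpow,
      show β*(1/(β-δ))*(q*(β-δ)) = β*q by field_simp, ← W_rpow, ← ENNReal.mul_rpow_of_nonneg _ _ hq.le, mul_assoc]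
    have : W α β z = ENNReal.ofReal ((1+|z.1|)^(-(α-β))) * W β β z := by
      rw [show W α β z = W ((α-β)+β) (0+β) z by simp, ← W_mul]
      congr 1
      simp [W]
    rw [this]
  simp_rw [hpt]
  calc _ ≤ ((∫⁻ z, (‖T F (Ioc 0 (2*π)) z‖ₑ * ENNReal.ofReal ((1+|z.1|)^(-(α-β))))^q')^(q*(1/q')) * I^(q*(β-δ)))^(1/q) := by
        gcongr
    _ = (∫⁻ z, (‖T F (Ioc 0 (2*π)) z‖ₑ * ENNReal.ofReal ((1+|z.1|)^(-(α-β))))^q')^(1/q') * I^(β-δ) := by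
        rw [ENNReal.mul_rpow_of_nonneg _ _ (by positivity), ← ENNReal.rpow_mul, ← ENNReal.rpow_mul]
        congr 2 <;> field_simp
    _ ≤ K * (∫⁻ φ in Ioc 0 (2*π), ‖F φ‖ₑ^r) ^ (1/r) * I^(β-δ) := by
        gcongr
        exact h F hF
    _ = _ := by ring

def refl1 (φ : ℝ) : ℝ := if φ < π/2 then π/2 - φ else 5*π/2 - φ

theorem refl1_meas : Measurable refl1 :=
  Measurable.ite measurableSet_Iio (by fun_prop) (by fun_prop)

theorem refl1_cos (φ : ℝ) : cos (refl1 φ) = sin φ := by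
  unfold refl1
  split_ifs
  · exact Real.cos_pi_div_two_sub φ
  · rw [show 5*π/2 - φ = (π/2 - φ) + 2*π by ring, Real.cos_add_two_pi]; exact Real.cos_pi_div_two_sub φ

theorem refl1_sin (φ : ℝ) : sin (refl1 φ) = cos φ := by
  unfold refl1
  split_ifs
  · exact Real.sin_pi_div_two_sub φ
  · rw [show 5*π/2 - φ = (π/2 - φ) + 2*π by ring, Real.sin_add_two_pi]; exact Real.sin_pi_div_two_sub φ

theorem refl1_map : (volume.restrict (Ioc 0 (2*π))).map refl1 = volume.restrict (Ioc 0 (2*π)) := by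
  have hpi := Real.pi_pos
  have hU : Ioc 0 (2*π) = Ioo 0 (π/2) ∪ Icc (π/2) (2*π) := by
    rw [Ioo_union_Icc_eq_Ioc (by linarith) (by linarith)]
  have hd : Disjoint (Ioo 0 (π/2)) (Icc (π/2) (2*π)) := by
    rw [Set.disjoint_left]; intro x h1 h2; exact absurd h1.2 (not_lt.2 h2.1)
  rw [hU, Measure.restrict_union hd measurableSet_Icc, Measure.map_add _ _ refl1_meas]
  congr 1
  · have h := ((Measure.measurePreserving_sub_left (volume : Measure ℝ) (π/2)).restrict_preimage (s := Ioo 0 (π/2)) measurableSet_Ioo).map_eq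
    have hp : (fun x => π/2 - x) ⁻¹' (Ioo 0 (π/2)) = Ioo 0 (π/2) := by
      ext x; simp only [mem_preimage, mem_Ioo]; constructor <;> rintro ⟨_, _⟩ <;> constructor <;> linarith
    rw [hp] at h
    rw [← h]
    nth_rewrite 1 [h]
    refine Measure.map_congr ?_
    filter_upwards [ae_restrict_mem measurableSet_Ioo] with x hx
    simp [refl1, hx.2]
  · have h := ((Measure.measurePreserving_sub_left (volume : Measure ℝ) (5*π/2)).restrict_preimage (s := Icc (π/2) (2*π)) measurableSet_Icc).map_eq
    have hp : (fun x => 5*π/2 - x) ⁻¹' (Icc (π/2) (2*π)) = Icc (π/2) (2*π) := by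
      ext x; simp only [mem_preimage, mem_Icc]; constructor <;> rintro ⟨_, _⟩ <;> constructor <;> linarith
    rw [hp] at h
    rw [← h]
    nth_rewrite 1 [h]
    refine Measure.map_congr ?_
    filter_upwards [ae_restrict_mem measurableSet_Icc] with x hx
    simp [refl1, not_lt.2 hx.1]

theorem P_symm (α β q r : ℝ) (h : P α β q r) : P β α q r := by
  obtain ⟨K, hK, h⟩ := h
  refine ⟨K, hK, fun F hF => ?_⟩
  have h1 := h (fun x => F (refl1 x)) (hF.comp refl1_meas)
  have e1 : ∫⁻ φ in Ioc 0 (2*π), ‖F (refl1 φ)‖ₑ^r = ∫⁻ φ in Ioc 0 (2*π), ‖F φ‖ₑ^r := by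
    conv_rhs => rw [← refl1_map]
    rw [lintegral_map (by fun_prop) refl1_meas]
  have e2 : ∀ z : ℝ × ℝ, T (fun x => F (refl1 x)) (Ioc 0 (2*π)) z.swap = T F (Ioc 0 (2*π)) z := by
    intro z
    unfold T
    conv_rhs => rw [← refl1_map]
    rw [integral_map refl1_meas.aemeasurable (by apply Measurable.aestronglyMeasurable; fun_prop)]
    simp only [refl1_cos, refl1_sin, Prod.fst_swap, Prod.snd_swap]
    congr 1; ext φ; rw [add_comm]
  rw [e1] at h1
  refine le_trans (le_of_eq ?_) h1
  congr 1
  rw [Measure.volume_eq_prod]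
  conv_rhs => rw [← lintegral_prod_swap]
  refine lintegral_congr fun z => ?_
  rw [e2]
  congr 2
  simp only [W, Prod.fst_swap, Prod.snd_swap]
  rw [mul_comm]

theorem P_ii (α β q r : ℝ) (hq : 0 < q) (hα : 0 ≤ α) (hβ : 0 ≤ β) (hm : max α β < 1/q) (hr : 1 ≤ r)
    (h2 : 2/q - 1/2 < α + β) (h3 : 3/q - (1-1/r) < α + β + min α β) : P α β q r := by
  rcases le_total β α with h | h
  · rw [min_eq_right h] at h3
    rw [max_eq_left h] at hm
    exact P_ii_le α β q r hq hβ h hm hr h2 (by linarith)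
  · rw [min_eq_left h] at h3
    rw [max_eq_right h] at hm
    exact P_symm _ _ _ _ (P_ii_le β α q r hq hα h hm hr (by linarith) (by linarith))

theorem P_i (α β q r : ℝ) (hq : 0 < q) (hα : 0 ≤ α) (hβ : 0 ≤ β) (hm : 1/q ≤ max α β) (hr : 1 ≤ r)
    (h3 : 2/q - (1-1/r) < 2 * min α β) : P α β q r := by
  have e2 : 2/q = 2*(1/q) := by ring
  have e3 : 3/q = 3*(1/q) := by ring
  rw [e2] at h3
  rcases hr.eq_or_lt with h1 | h1
  · subst h1
    have : 1/q < min α β := by rw [div_one, sub_self, sub_zero] at h3; linarith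
    rw [lt_min_iff] at this
    exact P_triv α β q hq this.1 this.2
  have hR : 1/r < 1 := by rw [div_lt_one (by linarith)]; exact h1
  have hR0 : 0 < 1/r := by positivity
  have hb : 0 < 1/q := by positivity
  set b := 1/q with hbd
  set R := 1/r with hRd
  wlog hβα : β ≤ α generalizing α β
  · exact P_symm _ _ _ _ (this β α hβ hα (by rwa [max_comm]) (by rwa [min_comm]) (le_of_not_ge hβα))
  rw [max_eq_left hβα] at hm
  rw [min_eq_right hβα] at h3
  obtain ⟨ε, hε0, hε⟩ := exists_between (show 0 < min (min b (1/4)) (min ((1-R)/3) ((2*β-(2*b-(1-R)))/2)) from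
    lt_min (lt_min hb (by norm_num)) (lt_min (by linarith) (by linarith)))
  rw [lt_min_iff, lt_min_iff, lt_min_iff] at hε
  obtain ⟨⟨hε1, hε2⟩, hε3, hε4⟩ := hε
  refine P_mono (b-ε) (min β (b-ε)) _ _ _ _ hq (by linarith) (min_le_left _ _) ?_
  refine P_ii _ _ _ _ hq (by linarith) (le_min hβ (by linarith)) ?_ hr ?_ ?_
  · rw [max_eq_left (min_le_right _ _)]; linarith
  · rw [e2]
    rcases le_total β (b-ε) with h | h
    · rw [min_eq_left h]; linarith
    · rw [min_eq_right h]; linarith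
  · rw [e3, min_eq_right (min_le_right _ _)]
    rcases le_total β (b-ε) with h | h
    · rw [min_eq_left h]; linarith
    · rw [min_eq_right h]; linarith


theorem P_main (α β : ℝ) (hα : 0 ≤ α) (hβ : 0 ≤ β)
    (r : ℝ≥0∞) (hr : 1 ≤ r) (q : ℝ) (hq : 0 < q)
    (hsum : α + β > 2 / q - 1 / 2)
    (hcase :
      (max α β ≥ 1 / q ∧ 2 * min α β > 2 / q - (1 - r⁻¹.toReal)) ∨
      (max α β < 1 / q ∧ α + β + min α β > 3 / q - (1 - r⁻¹.toReal))) :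
    ∃ r1 : ℝ, 1 ≤ r1 ∧ ENNReal.ofReal r1 ≤ r ∧ P α β q r1 := by
  have key : ∃ r1 : ℝ, 1 ≤ r1 ∧ ENNReal.ofReal r1 ≤ r ∧ 
     ((max α β ≥ 1 / q ∧ 2 * min α β > 2 / q - (1 - 1/r1)) ∨
      (max α β < 1 / q ∧ α + β + min α β > 3 / q - (1 - 1/r1))) := by
    by_cases ht : r = ∞
    · subst ht
      simp only [ENNReal.inv_top, ENNReal.toReal_zero, sub_zero] at hcase
      have hsm : ∀ g : ℝ, 0 < g → ∃ r1 : ℝ, 1 ≤ r1 ∧ 1/r1 < g := by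
        intro g hg
        refine ⟨1/g + 1, ?_, ?_⟩
        · have : 0 < 1/g := by positivity
          linarith
        · rw [div_lt_iff₀ (by positivity)]; field_simp; linarith
      rcases hcase with ⟨h1, h2⟩ | ⟨h1, h2⟩
      · obtain ⟨r1, hr1, hr2⟩ := hsm (2 * min α β - (2/q - 1)) (by linarith)
        exact ⟨r1, hr1, le_top, Or.inl ⟨h1, by linarith⟩⟩
      · obtain ⟨r1, hr1, hr2⟩ := hsm (α + β + min α β - (3/q - 1)) (by linarith)
        exact ⟨r1, hr1, le_top, Or.inr ⟨h1, by linarith⟩⟩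
    · refine ⟨r.toReal, ?_, ?_, ?_⟩
      · have := ENNReal.toReal_mono ht hr
        simpa using this
      · rw [ENNReal.ofReal_toReal ht]
      · rw [ENNReal.toReal_inv] at hcase
        simpa only [one_div] using hcase
  obtain ⟨r1, h1, h2, h3⟩ := key
  refine ⟨r1, h1, h2, ?_⟩
  rcases h3 with ⟨h3, h4⟩ | ⟨h3, h4⟩
  · exact P_i α β q r1 hq hα hβ h3 h1 h4
  · exact P_ii α β q r1 hq hα hβ h3 h1 hsum h4

theorem Rab_enorm (α β : ℝ) (F : ℝ → ℂ) (z : ℝ × ℝ) :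
    ‖Rab α β F z.1 z.2‖ₑ = ENNReal.ofReal (1/(2*π)) * (‖T F (Ioc 0 (2*π)) z‖ₑ * W α β z) := by
  have hpi := Real.pi_pos
  have e : Rext F z.1 z.2 = Complex.ofReal (1/(2*π)) * T F (Ioc 0 (2*π)) z := by
    unfold Rext T
    rw [intervalIntegral.integral_of_le (by positivity)]
    congr 2; ext φ; rw [mul_comm]
  have e2 : ∀ x : ℝ, 0 ≤ x → ‖Complex.ofReal x‖ₑ = ENNReal.ofReal x := by
    intro x hx
    rw [← ofReal_norm, Complex.norm_real, Real.norm_of_nonneg hx]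
  unfold Rab W
  rw [e, enorm_mul, enorm_mul, e2 _ (by positivity), e2 _ (by positivity), mul_assoc]

/-- Theorem 3 (sufficiency, non-endpoint cases): weighted restriction estimates for
`R*_{α,β}` with `1 ≤ r ≤ ∞` (as `ℝ≥0∞`), `0 < q < ∞`.  Here `1/r' = 1 - 1/r`
with `1/∞ = 0`. -/
theorem statement0 (α β : ℝ) (hα : 0 ≤ α) (hβ : 0 ≤ β)
    (r : ℝ≥0∞) (hr : 1 ≤ r) (q : ℝ) (hq : 0 < q)
    (hsum : α + β > 2 / q - 1 / 2)
    (hcase :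
      (max α β ≥ 1 / q ∧ 2 * min α β > 2 / q - (1 - r⁻¹.toReal)) ∨
      (max α β < 1 / q ∧ α + β + min α β > 3 / q - (1 - r⁻¹.toReal))) :
    ∃ C : ℝ, 0 < C ∧ ∀ F : ℝ → ℂ, Measurable F →
      planeLp (ENNReal.ofReal q) (fun p => Rab α β F p.1 p.2) ≤
        ENNReal.ofReal C * circleLp r F := by
  obtain ⟨r1, hr1, hr2, K, hK, hP⟩ := P_main α β hα hβ r hr q hq hsum hcase
  have hr10 : 0 < r1 := by linarith
  set c := ENNReal.ofReal (1/(2*π)) with hc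
  set m := (volume.restrict (Ioc (0:ℝ) (2*π))) univ ^ (1/(ENNReal.ofReal r1).toReal - 1/r.toReal) with hm
  have hmf : m ≠ ∞ := by
    refine ENNReal.rpow_ne_top_of_ne_zero ?_ ?_
    · simp [Real.pi_pos]
    · exact measure_ne_top _ _
  have hcf : c * K * m ≠ ∞ := ENNReal.mul_ne_top (ENNReal.mul_ne_top ENNReal.ofReal_ne_top hK) hmf
  refine ⟨(c * K * m).toReal + 1, by positivity, fun F hF => ?_⟩
  have h0 : ENNReal.ofReal q ≠ 0 := by simpa using hq
  have h1 : planeLp (ENNReal.ofReal q) (fun p => Rab α β F p.1 p.2) ≤ c * (K * eLpNorm F (ENNReal.ofReal r1) (volume.restrict (Ioc (0:ℝ) (2*π)))) := by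
    unfold planeLp
    rw [eLpNorm_eq_lintegral_rpow_enorm_toReal h0 ENNReal.ofReal_ne_top,
      eLpNorm_eq_lintegral_rpow_enorm_toReal (by simpa using hr10) ENNReal.ofReal_ne_top,
      ENNReal.toReal_ofReal hq.le, ENNReal.toReal_ofReal hr10.le]
    simp_rw [Rab_enorm, ← hc, ENNReal.mul_rpow_of_nonneg c _ hq.le]
    rw [lintegral_const_mul' _ _ (ENNReal.rpow_ne_top_of_nonneg hq.le ENNReal.ofReal_ne_top),
      ENNReal.mul_rpow_of_nonneg _ _ (by positivity), ← ENNReal.rpow_mul, mul_one_div_cancel hq.ne', ENNReal.rpow_one]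
    gcongr
    exact hP F hF
  have h2 := eLpNorm_le_eLpNorm_mul_rpow_measure_univ (μ := volume.restrict (Ioc (0:ℝ) (2*π))) (f := F) hr2 hF.aestronglyMeasurable
  unfold circleLp
  calc _ ≤ c * (K * (eLpNorm F r (volume.restrict (Ioc (0:ℝ) (2*π))) * m)) := by
        refine h1.trans ?_
        gcongr
    _ = (c * K * m) * eLpNorm F r (volume.restrict (Ioc (0:ℝ) (2*π))) := by ring
    _ ≤ _ := by
        gcongr
        rw [← ENNReal.ofReal_toReal hcf]
        apply ENNReal.ofReal_le_ofReal
        rw [ENNReal.toReal_ofReal (by positivity)]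
        linarith
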